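/- arXiv:1802.01848 — 4 statements merged into one kernel-verified Lean document; each statement's English description precedes it below -/
import Mathlib

section
/- Let A be a finite-dimensional K-algebra, E a basic cogenerating A-module, Γ = End_A(E)^op, P = D E, and let B be the cogenerator-tilted algebra of E with special idempotent e and corresponding intermediate extension functor c : mod A → mod B. Then c(E) ≅ D T_P and c(DA) ≅ D(eB). In particular c(DA) is an injective B-module. -/
/- Preliminary notions: `add`, `gen`, `cogen`, generators and cogenerators,
short exact sequences, basic modules, indecomposability. -/

noncomputable section

namespace GenFinitePaper

open Function

variable (R : Type) [Ring R]

/-- `M` lies in `add X`, i.e. `M` is a direct summand of a finite direct sum of copies of `X`. -/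
def InAdd (X : Type) [AddCommGroup X] [Module R X]
    (M : Type) [AddCommGroup M] [Module R M] : Prop :=
  ∃ (n : ℕ) (i : M →ₗ[R] (Fin n → X)) (p : (Fin n → X) →ₗ[R] M), p.comp i = LinearMap.id

/-- `M` lies in `gen X`, i.e. `M` is an epimorphic image of a module in `add X`. -/
def InGen (X : Type) [AddCommGroup X] [Module R X]
    (M : Type) [AddCommGroup M] [Module R M] : Prop :=
  ∃ (n : ℕ) (p : (Fin n → X) →ₗ[R] M), Surjective p

/-- `M` lies in `cogen X`, i.e. `M` embeds into a module in `add X`. -/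
def InCogen (X : Type) [AddCommGroup X] [Module R X]
    (M : Type) [AddCommGroup M] [Module R M] : Prop :=
  ∃ (n : ℕ) (i : M →ₗ[R] (Fin n → X)), Injective i

/-- `E` is a generator for `mod R`: `R ∈ add E`. -/
def IsGenerator (E : Type) [AddCommGroup E] [Module R E] : Prop :=
  InAdd R E R

/-- `E` is a cogenerator for `mod R`: every finitely generated (equivalently, over a
finite-dimensional algebra, finite-dimensional) module embeds into a module in `add E`. -/
def IsCogenerator (E : Type) [AddCommGroup E] [Module R E] : Prop :=
  ∀ (M : Type) [AddCommGroup M] [Module R M], Module.Finite R M → InCogen R E M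

/-- A short exact sequence `0 → X → Y → Z → 0` of modules, given by a pair of composable
linear maps. -/
def IsShortExact {X Y Z : Type} [AddCommGroup X] [Module R X] [AddCommGroup Y] [Module R Y]
    [AddCommGroup Z] [Module R Z] (f : X →ₗ[R] Y) (g : Y →ₗ[R] Z) : Prop :=
  Injective f ∧ Surjective g ∧ Exact f g

/-- A module is basic if it has no repeated indecomposable direct summands; equivalently
(by Krull--Remak--Schmidt) no nonzero module `X` is such that `X ⊕ X` is a direct summand. -/
def IsBasic (M : Type) [AddCommGroup M] [Module R M] : Prop :=
  ∀ (X Y : Type) [AddCommGroup X] [Module R X] [AddCommGroup Y] [Module R Y],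
    Nonempty (M ≃ₗ[R] ((X × X) × Y)) → Subsingleton X

/-- A module is indecomposable if it is nonzero and admits no nontrivial idempotent
endomorphism. -/
def Indecomposable (M : Type) [AddCommGroup M] [Module R M] : Prop :=
  Nontrivial M ∧ ∀ φ : M →ₗ[R] M, φ.comp φ = φ → φ = 0 ∨ φ = LinearMap.id

end GenFinitePaper
/- K-linear duality: the dual of the regular module, duals of modules over endomorphism
rings, and Hom-modules over endomorphism rings. -/

namespace GenFinitePaper

open Function

variable (K : Type) [Field K]

/-- `D R = Hom_K(R, K)`, the `K`-linear dual of a `K`-algebra `R`, viewed as a left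
`R`-module via `(r • f) x = f (x * r)`. -/
def RegularDual (R : Type) [Ring R] [Algebra K R] : Type := R →ₗ[K] K

namespace RegularDual

variable (R : Type) [Ring R] [Algebra K R]

instance : AddCommGroup (RegularDual K R) := inferInstanceAs (AddCommGroup (R →ₗ[K] K))

instance : Module K (RegularDual K R) := inferInstanceAs (Module K (R →ₗ[K] K))

/-- The action of `R` on its `K`-linear dual, by `(r • f) x = f (x * r)`. -/
def actHom : R →+* Module.End K (R →ₗ[K] K) where
  toFun r := (LinearMap.mulRight K r).lcomp K K
  map_one' := by ext f x; simp
  map_mul' r s := by ext f x; simp [mul_assoc]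
  map_zero' := by ext f x; simp
  map_add' r s := by ext f x; simp [mul_add]

instance : Module R (RegularDual K R) :=
  Module.compHom (R →ₗ[K] K) (actHom K R)

lemma smul_def (r : R) (f : RegularDual K R) :
    r • f = (f : R →ₗ[K] K).comp (LinearMap.mulRight K r) := rfl

end RegularDual

/-- `D M = Hom_K(M, K)`, the `K`-linear dual of a module `M` over a `K`-algebra `R`,
viewed as a left module over `End_R(M)ᵒᵖ` via `(φᵒᵖ • f) = f ∘ φ`. -/
def ModuleDual (R : Type) [Ring R] [Algebra K R] (M : Type) [AddCommGroup M] [Module R M]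
    [Module K M] [IsScalarTower K R M] : Type := M →ₗ[K] K

namespace ModuleDual

variable (R : Type) [Ring R] [Algebra K R] (M : Type) [AddCommGroup M] [Module R M]
  [Module K M] [IsScalarTower K R M]

instance : AddCommGroup (ModuleDual K R M) := inferInstanceAs (AddCommGroup (M →ₗ[K] K))

instance : Module K (ModuleDual K R M) := inferInstanceAs (Module K (M →ₗ[K] K))

/-- The action of `End_R(M)ᵒᵖ` on `Hom_K(M, K)` by precomposition. -/
def actHom : (Module.End R M)ᵐᵒᵖ →+* Module.End K (M →ₗ[K] K) where
  toFun φ := (LinearMap.restrictScalars K φ.unop).lcomp K K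
  map_one' := by ext f x; rfl
  map_mul' φ ψ := by ext f x; rfl
  map_zero' := by ext f x; simp
  map_add' φ ψ := by ext f x; simp

instance : Module (Module.End R M)ᵐᵒᵖ (ModuleDual K R M) :=
  Module.compHom (M →ₗ[K] K) (actHom K R M)

lemma smul_def (φ : (Module.End R M)ᵐᵒᵖ) (f : ModuleDual K R M) :
    φ • f = (f : M →ₗ[K] K).comp (LinearMap.restrictScalars K φ.unop) := rfl

end ModuleDual

/-- `Hom_R(E, N)` viewed as a left module over `Γ = End_R(E)ᵒᵖ` via `(φᵒᵖ • g) = g ∘ φ`. -/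
def HomOp (R : Type) [Ring R] (E : Type) [AddCommGroup E] [Module R E]
    (N : Type) [AddCommGroup N] [Module R N] : Type := E →ₗ[R] N

namespace HomOp

variable (R : Type) [Ring R] (E : Type) [AddCommGroup E] [Module R E]
  (N : Type) [AddCommGroup N] [Module R N]

instance : AddCommGroup (HomOp R E N) := inferInstanceAs (AddCommGroup (E →ₗ[R] N))

/-- The action of `End_R(E)ᵒᵖ` on `Hom_R(E, N)` by precomposition. -/
def actHom : (Module.End R E)ᵐᵒᵖ →+* Module.End ℤ (E →ₗ[R] N) where
  toFun φ :=
    { toFun := fun g => (g : E →ₗ[R] N).comp φ.unop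
      map_add' := fun g h => LinearMap.add_comp _ _ _
      map_smul' := fun n g => LinearMap.smul_comp n g φ.unop }
  map_one' := by ext g x; rfl
  map_mul' φ ψ := by ext g x; rfl
  map_zero' := by ext g x; simp
  map_add' φ ψ := by ext g x; simp

instance : Module (Module.End R E)ᵐᵒᵖ (HomOp R E N) :=
  Module.compHom (E →ₗ[R] N) (actHom R E N)

lemma smul_def (φ : (Module.End R E)ᵐᵒᵖ) (g : HomOp R E N) :
    φ • g = (g : E →ₗ[R] N).comp φ.unop := rfl

end HomOp

end GenFinitePaper

namespace GenFinitePaper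

/-- Unfold a `RegularDual` element to a linear map. -/
def RegularDual.toLin (K : Type) [Field K] (R : Type) [Ring R] [Algebra K R]
    (f : RegularDual K R) : R →ₗ[K] K := f

/-- Unfold a `ModuleDual` element to a linear map. -/
def ModuleDual.toLin (K : Type) [Field K] (R : Type) [Ring R] [Algebra K R]
    (M : Type) [AddCommGroup M] [Module R M] [Module K M] [IsScalarTower K R M]
    (f : ModuleDual K R M) : M →ₗ[K] K := f

/-- Unfold a `HomOp` element to a linear map. -/
def HomOp.toLin (R : Type) [Ring R] (E : Type) [AddCommGroup E] [Module R E]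
    (N : Type) [AddCommGroup N] [Module R N] (g : HomOp R E N) : E →ₗ[R] N := g

end GenFinitePaper
/- Tilting and cotilting modules, and special (co)tilting modules. -/

namespace GenFinitePaper

open Function

variable (Γ : Type) [Ring Γ]

/-- A (classical) tilting module:
(T1) projective dimension at most 1;
(T2) no self-extensions (every short exact sequence `0 → T → X → T → 0` splits);
(T3) an exact sequence `0 → Γ → T₀ → T₁ → 0` with `T₀, T₁ ∈ add T`. -/
structure IsTilting (T : Type) [AddCommGroup T] [Module Γ T] : Prop where
  pdim_le_one : ∃ (P₁ P₀ : Type) (_ : AddCommGroup P₁) (_ : Module Γ P₁)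
      (_ : AddCommGroup P₀) (_ : Module Γ P₀) (f : P₁ →ₗ[Γ] P₀) (g : P₀ →ₗ[Γ] T),
      Module.Projective Γ P₁ ∧ Module.Projective Γ P₀ ∧ IsShortExact Γ f g
  rigid : ∀ (X : Type) [AddCommGroup X] [Module Γ X], ∀ (f : T →ₗ[Γ] X) (g : X →ₗ[Γ] T),
      IsShortExact Γ f g → ∃ r : X →ₗ[Γ] T, r.comp f = LinearMap.id
  coresolves : ∃ (T₀ T₁ : Type) (_ : AddCommGroup T₀) (_ : Module Γ T₀)
      (_ : AddCommGroup T₁) (_ : Module Γ T₁) (f : Γ →ₗ[Γ] T₀) (g : T₀ →ₗ[Γ] T₁),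
      InAdd Γ T T₀ ∧ InAdd Γ T T₁ ∧ IsShortExact Γ f g

/-- A `P`-special tilting module, for `P` a projective module: a tilting module `T` with
`P ∈ add T` such that the module `T₀` in (T3) can be chosen in `add P`. -/
structure IsSpecialTilting (P : Type) [AddCommGroup P] [Module Γ P]
    (T : Type) [AddCommGroup T] [Module Γ T] : Prop where
  isTilting : IsTilting Γ T
  mem_add : InAdd Γ T P
  coresolves_special : ∃ (T₀ T₁ : Type) (_ : AddCommGroup T₀) (_ : Module Γ T₀)
      (_ : AddCommGroup T₁) (_ : Module Γ T₁) (f : Γ →ₗ[Γ] T₀) (g : T₀ →ₗ[Γ] T₁),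
      InAdd Γ P T₀ ∧ InAdd Γ T T₁ ∧ IsShortExact Γ f g

variable (K : Type) [Field K] [Algebra K Γ]

/-- A (classical) cotilting module:
(C1) injective dimension at most 1;
(C2) no self-extensions;
(C3) an exact sequence `0 → C1 → C0 → DΓ → 0` with `C0, C1 ∈ add C`,
where `DΓ` is the `K`-linear dual of the regular module. -/
structure IsCotilting (C : Type) [AddCommGroup C] [Module Γ C] : Prop where
  idim_le_one : ∃ (I0 I1 : Type) (_ : AddCommGroup I0) (_ : Module Γ I0)
      (_ : AddCommGroup I1) (_ : Module Γ I1) (f : C →ₗ[Γ] I0) (g : I0 →ₗ[Γ] I1),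
      Module.Injective Γ I0 ∧ Module.Injective Γ I1 ∧ IsShortExact Γ f g
  rigid : ∀ (X : Type) [AddCommGroup X] [Module Γ X], ∀ (f : C →ₗ[Γ] X) (g : X →ₗ[Γ] C),
      IsShortExact Γ f g → ∃ r : X →ₗ[Γ] C, r.comp f = LinearMap.id
  resolves : ∃ (C1 C0 : Type) (_ : AddCommGroup C1) (_ : Module Γ C1)
      (_ : AddCommGroup C0) (_ : Module Γ C0) (f : C1 →ₗ[Γ] C0)
      (g : C0 →ₗ[Γ] RegularDual K Γ),
      InAdd Γ C C1 ∧ InAdd Γ C C0 ∧ IsShortExact Γ f g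

/-- A `Q`-special cotilting module, for `Q` an injective module: a cotilting module `C` with
`Q ∈ add C` such that the module `C0` in (C3) can be chosen in `add Q`. -/
structure IsSpecialCotilting (Q : Type) [AddCommGroup Q] [Module Γ Q]
    (C : Type) [AddCommGroup C] [Module Γ C] : Prop where
  isCotilting : IsCotilting Γ K C
  mem_add : InAdd Γ C Q
  resolves_special : ∃ (C1 C0 : Type) (_ : AddCommGroup C1) (_ : Module Γ C1)
      (_ : AddCommGroup C0) (_ : Module Γ C0) (f : C1 →ₗ[Γ] C0)
      (g : C0 →ₗ[Γ] RegularDual K Γ),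
      InAdd Γ Q C0 ∧ InAdd Γ C C1 ∧ IsShortExact Γ f g

end GenFinitePaper
/- Idempotent corners, stable and costable modules, and the intermediate extension functor
associated to an idempotent, characterised on objects. -/

namespace GenFinitePaper

open Function

variable (A B : Type) [Ring A] [Ring B]

/-- An identification of a ring `A` with the corner `eBe` of a ring `B` at an idempotent
`e` (the data of the multiplicative, additive map `A → B` landing in the corner). -/
structure CornerMap (e : B) where
  toHom : A →+ B
  map_mul : ∀ a b : A, toHom (a * b) = toHom a * toHom b
  map_one : toHom 1 = e
  mem_left : ∀ a : A, e * toHom a = toHom a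
  mem_right : ∀ a : A, toHom a * e = toHom a

/-- A full corner identification: additionally bijective onto `eBe`. -/
structure CornerIso (e : B) extends CornerMap A B e where
  inj : Function.Injective toHom
  surj : ∀ b : B, e * b = b → b * e = b → ∃ a : A, toHom a = b

variable {A B}

/-- The subgroup `eY` of a `B`-module `Y`, which is a module over `A ≅ eBe`. -/
def ePart {e : B} (φ : CornerMap A B e) (Y : Type) [AddCommGroup Y] [Module B Y] : Type :=
  {y : Y // e • y = y}

namespace ePart

variable {e : B} (φ : CornerMap A B e) (Y : Type) [AddCommGroup Y] [Module B Y]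

/-- The underlying element of `Y`. -/
def val (y : ePart φ Y) : Y := Subtype.val y

lemma prop (y : ePart φ Y) : e • y.val = y.val := Subtype.property y

/-- The `e`-part of a module, as an additive subgroup. -/
def addSubgroup : AddSubgroup Y where
  carrier := {y | e • y = y}
  add_mem' := fun {a b} ha hb => by
    simp only [Set.mem_setOf_eq] at *
    rw [smul_add, ha, hb]
  zero_mem' := smul_zero e
  neg_mem' := fun {a} ha => by
    simp only [Set.mem_setOf_eq] at *
    rw [smul_neg, ha]

instance : AddCommGroup (ePart φ Y) :=
  inferInstanceAs (AddCommGroup (addSubgroup (e := e) Y))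

/-- The action of `A ≅ eBe` on `eY`. -/
def actHom : A →+* Module.End ℤ (ePart φ Y) where
  toFun a :=
    { toFun := fun y => ⟨φ.toHom a • y.val, by rw [← mul_smul, φ.mem_left]⟩
      map_add' := fun y z => Subtype.ext (smul_add (φ.toHom a) y.val z.val)
      map_smul' := fun n y => Subtype.ext (by
        show φ.toHom a • (n • y).val = n • (φ.toHom a • y.val)
        have : (n • y).val = n • y.val := rfl
        rw [this, smul_comm]) }
  map_one' := by
    refine LinearMap.ext fun y => Subtype.ext ?_
    show φ.toHom 1 • y.val = y.val
    rw [φ.map_one]; exact y.prop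
  map_mul' a b := by
    refine LinearMap.ext fun y => Subtype.ext ?_
    show φ.toHom (a * b) • y.val = φ.toHom a • φ.toHom b • y.val
    rw [φ.map_mul, mul_smul]
  map_zero' := by
    refine LinearMap.ext fun y => Subtype.ext ?_
    show φ.toHom 0 • y.val = 0
    rw [map_zero, zero_smul]
  map_add' a b := by
    refine LinearMap.ext fun y => Subtype.ext ?_
    show φ.toHom (a + b) • y.val = φ.toHom a • y.val + φ.toHom b • y.val
    rw [map_add, add_smul]

instance : Module A (ePart φ Y) :=
  Module.compHom (ePart φ Y) (actHom φ Y)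

lemma smul_def (a : A) (y : ePart φ Y) : (a • y).val = φ.toHom a • y.val := rfl

end ePart

variable (B)

/-- A `B`-module is stable (lies in `cogen D(eB)`) if it has no nonzero submodule killed
by the idempotent `e`, i.e. `eBy ≠ 0` for `y ≠ 0`. -/
def IsStableMod (e : B) (Y : Type) [AddCommGroup Y] [Module B Y] : Prop :=
  ∀ y : Y, (∀ b : B, e • (b • y) = (0 : Y)) → y = 0

/-- A `B`-module is costable (lies in `gen Be`) if it is generated by `eY`:
`B • (e • Y) = Y`. -/
def IsCostableMod (e : B) (Y : Type) [AddCommGroup Y] [Module B Y] : Prop :=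
  (⊤ : Submodule B Y) ≤ Submodule.span B {z : Y | ∃ w : Y, z = e • w}

variable {B}

/-- `Y` is (isomorphic to) the intermediate extension `c(M)` of the `A`-module `M` along
the idempotent `e`: it is stable and costable (so lies in the image of the intermediate
extension functor), and `eY ≅ M` over `A ≅ eBe`.  This characterises `c(M)` uniquely up
to isomorphism. -/
def IsIntermediateExtension {e : B} (φ : CornerMap A B e)
    (M : Type) [AddCommGroup M] [Module A M]
    (Y : Type) [AddCommGroup Y] [Module B Y] : Prop :=
  IsCostableMod B e Y ∧ IsStableMod B e Y ∧ Nonempty (ePart φ Y ≃ₗ[A] M)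

variable (B)

/-- The left ideal `Be`, for `e` an idempotent of `B`. -/
def leftCornerIdeal (e : B) : Submodule B B where
  carrier := {b | b * e = b}
  add_mem' := fun {a b} ha hb => by
    simp only [Set.mem_setOf_eq] at *
    rw [add_mul, ha, hb]
  zero_mem' := zero_mul e
  smul_mem' := fun c {x} hx => by
    simp only [Set.mem_setOf_eq, smul_eq_mul] at *
    rw [mul_assoc, hx]

variable (K : Type) [Field K] [Algebra K B]

/-- The right ideal `eB`, for `e` an idempotent of `B`, as a `K`-subspace of `B`. -/
def rightCornerSubspace (e : B) : Submodule K B where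
  carrier := {b | e * b = b}
  add_mem' := fun {a b} ha hb => by
    simp only [Set.mem_setOf_eq] at *
    rw [mul_add, ha, hb]
  zero_mem' := mul_zero e
  smul_mem' := fun k {x} hx => by
    simp only [Set.mem_setOf_eq] at *
    rw [mul_smul_comm, hx]

/-- `D(eB) = Hom_K(eB, K)`, as a left `B`-module via `(c • f) x = f (x * c)`. -/
def CornerDual (e : B) : Type := rightCornerSubspace B K e →ₗ[K] K

namespace CornerDual

variable (e : B)

instance : AddCommGroup (CornerDual B K e) :=
  inferInstanceAs (AddCommGroup (rightCornerSubspace B K e →ₗ[K] K))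

instance : Module K (CornerDual B K e) :=
  inferInstanceAs (Module K (rightCornerSubspace B K e →ₗ[K] K))

/-- Right multiplication by `c : B` on the right ideal `eB`, as a `K`-linear map. -/
def rmul (c : B) : rightCornerSubspace B K e →ₗ[K] rightCornerSubspace B K e where
  toFun x := ⟨(x : B) * c, by
    have hx : e * (x : B) = (x : B) := x.2
    show e * ((x : B) * c) = (x : B) * c
    rw [← mul_assoc, hx]⟩
  map_add' x y := Subtype.ext (add_mul _ _ _)
  map_smul' k x := Subtype.ext (smul_mul_assoc k (x : B) c)

/-- The action of `B` on `D(eB)` by `(c • f) x = f (x * c)`. -/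
def actHom : B →+* Module.End K (rightCornerSubspace B K e →ₗ[K] K) where
  toFun c := (rmul B K e c).lcomp K K
  map_one' := by
    ext f x
    show f (rmul B K e 1 x) = f x
    congr 1
    exact Subtype.ext (mul_one _)
  map_mul' c d := by
    ext f x
    show f (rmul B K e (c * d) x) = f (rmul B K e d (rmul B K e c x))
    congr 1
    exact Subtype.ext (mul_assoc _ _ _).symm
  map_zero' := by
    ext f x
    show f (rmul B K e 0 x) = 0
    have h0 : rmul B K e 0 x = 0 := Subtype.ext (mul_zero _)
    rw [h0, map_zero]
  map_add' c d := by
    ext f x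
    show f (rmul B K e (c + d) x) = f (rmul B K e c x) + f (rmul B K e d x)
    have h : rmul B K e (c + d) x = rmul B K e c x + rmul B K e d x :=
      Subtype.ext (mul_add _ _ _)
    rw [h, map_add]

instance : Module B (CornerDual B K e) :=
  Module.compHom (rightCornerSubspace B K e →ₗ[K] K) (actHom B K e)

end CornerDual

end GenFinitePaper
/- The canonical corner identification of `A` with `e B e`, where `B` is the endomorphism
algebra of a module over `Γ = End_A(E)ᵒᵖ` having the dual `D E` as a direct summand, and
`e` is the idempotent given by projection onto that summand. -/

namespace GenFinitePaper

open Function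

section Canon

variable (K A : Type) [Field K] [Ring A] [Algebra K A]
variable (E : Type) [AddCommGroup E] [Module A E] [Module K E] [IsScalarTower K A E]

/-- The action of `a : A` on `E`, as a `K`-linear map. -/
def smulKLin (a : A) : E →ₗ[K] E where
  toFun x := a • x
  map_add' x y := smul_add a x y
  map_smul' k x := by
    simp only [RingHom.id_apply]
    rw [← algebraMap_smul A k x, ← mul_smul, ← Algebra.commutes k a, mul_smul,
      algebraMap_smul]

/-- The right action of `a : A` on `D E = Hom_K(E, K)` by precomposition, as an
endomorphism of the `Γ = End_A(E)ᵒᵖ`-module `D E`. -/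
def dualAct (a : A) :
    ModuleDual K A E →ₗ[(Module.End A E)ᵐᵒᵖ] ModuleDual K A E where
  toFun f := (ModuleDual.toLin K A E f).comp (smulKLin K A E a)
  map_add' f g := LinearMap.add_comp _ _ _
  map_smul' γ f := by
    simp only [RingHom.id_apply]
    refine LinearMap.ext fun x => ?_
    show ModuleDual.toLin K A E f (γ.unop (a • x)) = ModuleDual.toLin K A E f (a • γ.unop x)
    rw [map_smul]

lemma dualAct_one : dualAct K A E 1 = LinearMap.id := by
  refine LinearMap.ext fun f => ?_
  refine LinearMap.ext fun x => ?_
  show ModuleDual.toLin K A E f ((1 : A) • x) = ModuleDual.toLin K A E f x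
  rw [one_smul]

lemma dualAct_mul (a b : A) :
    (dualAct K A E b).comp (dualAct K A E a) = dualAct K A E (a * b) := by
  refine LinearMap.ext fun f => ?_
  refine LinearMap.ext fun x => ?_
  show ModuleDual.toLin K A E f (a • b • x) = ModuleDual.toLin K A E f ((a * b) • x)
  rw [mul_smul]

variable (T : Type) [AddCommGroup T] [Module (Module.End A E)ᵐᵒᵖ T]
variable (i₀ : ModuleDual K A E →ₗ[(Module.End A E)ᵐᵒᵖ] T)
variable (p₀ : T →ₗ[(Module.End A E)ᵐᵒᵖ] ModuleDual K A E)

/-- The canonical identification of `A` with the corner of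
`B = End_Γ(T)ᵒᵖ` at the idempotent `e` given by projection onto a direct summand
`D E` of `T`, sending `a` to the endomorphism acting by `a` on this summand. -/
def canonicalCornerMap (hsplit : p₀.comp i₀ = LinearMap.id) :
    CornerMap A (Module.End (Module.End A E)ᵐᵒᵖ T)ᵐᵒᵖ (MulOpposite.op (i₀.comp p₀)) where
  toHom :=
    { toFun := fun a => MulOpposite.op ((i₀.comp (dualAct K A E a)).comp p₀)
      map_zero' := by
        rw [← MulOpposite.op_zero]
        refine congrArg MulOpposite.op ?_
        refine LinearMap.ext fun t => ?_
        have h0 : dualAct K A E 0 (p₀ t) = 0 := by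
          refine LinearMap.ext fun x => ?_
          show ModuleDual.toLin K A E (p₀ t) ((0 : A) • x) = 0
          rw [zero_smul, map_zero]
        show i₀ (dualAct K A E 0 (p₀ t)) = 0
        rw [h0, map_zero]
      map_add' := fun a b => by
        rw [← MulOpposite.op_add]
        refine congrArg MulOpposite.op ?_
        refine LinearMap.ext fun t => ?_
        have h : dualAct K A E (a + b) (p₀ t) =
            dualAct K A E a (p₀ t) + dualAct K A E b (p₀ t) := by
          refine LinearMap.ext fun x => ?_
          show ModuleDual.toLin K A E (p₀ t) ((a + b) • x) =
            ModuleDual.toLin K A E (p₀ t) (a • x) + ModuleDual.toLin K A E (p₀ t) (b • x)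
          rw [add_smul, map_add]
        show i₀ (dualAct K A E (a + b) (p₀ t)) = i₀ (dualAct K A E a (p₀ t)) +
          i₀ (dualAct K A E b (p₀ t))
        rw [h, map_add] }
  map_mul := fun a b => by
    show MulOpposite.op _ = MulOpposite.op _ * MulOpposite.op _
    rw [← MulOpposite.op_mul]
    refine congrArg MulOpposite.op ?_
    have hsp : ∀ z, p₀ (i₀ z) = z := fun z => LinearMap.ext_iff.mp hsplit z
    refine LinearMap.ext fun t => ?_
    show i₀ (dualAct K A E (a * b) (p₀ t)) =
      i₀ (dualAct K A E b (p₀ (i₀ (dualAct K A E a (p₀ t)))))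
    rw [hsp, ← dualAct_mul]
    rfl
  map_one := by
    show MulOpposite.op _ = MulOpposite.op _
    refine congrArg MulOpposite.op ?_
    rw [dualAct_one]
    rfl
  mem_left := fun a => by
    show MulOpposite.op _ * MulOpposite.op _ = MulOpposite.op _
    rw [← MulOpposite.op_mul]
    refine congrArg MulOpposite.op ?_
    have hsp : ∀ z, p₀ (i₀ z) = z := fun z => LinearMap.ext_iff.mp hsplit z
    refine LinearMap.ext fun t => ?_
    show i₀ (dualAct K A E a (p₀ (i₀ (p₀ t)))) = i₀ (dualAct K A E a (p₀ t))
    rw [hsp]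
  mem_right := fun a => by
    show MulOpposite.op _ * MulOpposite.op _ = MulOpposite.op _
    rw [← MulOpposite.op_mul]
    refine congrArg MulOpposite.op ?_
    have hsp : ∀ z, p₀ (i₀ z) = z := fun z => LinearMap.ext_iff.mp hsplit z
    refine LinearMap.ext fun t => ?_
    show i₀ (p₀ (i₀ (dualAct K A E a (p₀ t)))) = i₀ (dualAct K A E a (p₀ t))
    rw [hsp]

end Canon

end GenFinitePaper

namespace GenFinitePaper

open Function

section Extensions

variable {R : Type} [Ring R] {T : Type} [AddCommGroup T] [Module R T]

/-- If every self-extension of `T` splits, then maps from `T` lift along every epimorphism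
with kernel `T`. -/
lemma exists_lift_of_rigid
    (hT : ∀ (X : Type) [AddCommGroup X] [Module R X], ∀ (f : T →ₗ[R] X) (g : X →ₗ[R] T),
      IsShortExact R f g → ∃ r : X →ₗ[R] T, r.comp f = LinearMap.id)
    {X N : Type} [AddCommGroup X] [Module R X] [AddCommGroup N] [Module R N]
    {f : T →ₗ[R] X} {g : X →ₗ[R] N} (h : IsShortExact R f g) (u : T →ₗ[R] N) :
    ∃ s : T →ₗ[R] X, g.comp s = u := by
  obtain ⟨hf, hg, hfg⟩ := h
  let Q : Submodule R (X × T) :=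
    LinearMap.eqLocus (g.comp (LinearMap.fst R X T)) (u.comp (LinearMap.snd R X T))
  have hQ : ∀ z : X × T, z ∈ Q ↔ g z.1 = u z.2 := fun z => Iff.rfl
  let f' : T →ₗ[R] Q := LinearMap.codRestrict Q ((LinearMap.inl R X T).comp f) (fun t => by
    simp [hQ, hfg.apply_apply_eq_zero])
  let g' : Q →ₗ[R] T := (LinearMap.snd R X T).comp Q.subtype
  have hex : Exact f' g' := by
    rintro ⟨⟨x, t⟩, hz⟩
    constructor
    · intro h0
      have h0 : t = 0 := h0
      subst h0
      have hx : g x = 0 := by simpa [hQ] using hz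
      obtain ⟨s, rfl⟩ := (hfg x).1 hx
      exact ⟨s, rfl⟩
    · rintro ⟨s, hs⟩
      have := congrArg (fun w : Q => w.1.2) hs
      exact this.symm
  have hse : IsShortExact R f' g' := by
    refine ⟨fun a b hab => hf (congrArg (fun w : Q => w.1.1) hab), fun t => ?_, hex⟩
    obtain ⟨x, hx⟩ := hg (u t)
    exact ⟨⟨(x, t), hx⟩, rfl⟩
  obtain ⟨r, hr⟩ := hT Q f' g' hse
  obtain ⟨-, l, hl⟩ := (hex.split_tfae'.out 0 1 rfl rfl).2 ⟨hse.2.1, r, hr⟩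
  refine ⟨(LinearMap.fst R X T).comp (Q.subtype.comp l), LinearMap.ext fun t => ?_⟩
  have h1 : g (l t).1.1 = u (l t).1.2 := (l t).2
  have h2 : (l t).1.2 = t := LinearMap.congr_fun hl t
  rw [h2] at h1
  exact h1

/-- If every self-extension of `T` splits and `W ∈ add T`, then `Ext¹(W, T) = 0`: maps to `T`
extend along every monomorphism with cokernel `W`. -/
lemma exists_extension_of_rigid
    (hT : ∀ (X : Type) [AddCommGroup X] [Module R X], ∀ (f : T →ₗ[R] X) (g : X →ₗ[R] T),
      IsShortExact R f g → ∃ r : X →ₗ[R] T, r.comp f = LinearMap.id)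
    {U V W : Type} [AddCommGroup U] [Module R U] [AddCommGroup V] [Module R V]
    [AddCommGroup W] [Module R W] (hW : InAdd R T W)
    {f : U →ₗ[R] V} {g : V →ₗ[R] W} (h : IsShortExact R f g) (u : U →ₗ[R] T) :
    ∃ v : V →ₗ[R] T, v.comp f = u := by
  obtain ⟨hf, hg, hfg⟩ := h
  let S : Submodule R (T × V) := LinearMap.range (LinearMap.prod u (-f))
  let f' : T →ₗ[R] (T × V) ⧸ S := S.mkQ.comp (LinearMap.inl R T V)
  have hS : S ≤ LinearMap.ker (g.comp (LinearMap.snd R T V)) := by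
    rintro _ ⟨x, rfl⟩
    simp [hfg.apply_apply_eq_zero]
  let g' : ((T × V) ⧸ S) →ₗ[R] W := S.liftQ (g.comp (LinearMap.snd R T V)) hS
  have hcomm : ∀ x, S.mkQ (0, f x) = f' (u x) := fun x => by
    refine (Submodule.Quotient.eq S).2 ⟨-x, ?_⟩
    simp
  have hex : Exact f' g' := by
    intro y
    obtain ⟨⟨t, v⟩, rfl⟩ := S.mkQ_surjective y
    constructor
    · intro h0
      have h0 : g v = 0 := h0
      obtain ⟨x, rfl⟩ := (hfg v).1 h0
      refine ⟨t + u x, ?_⟩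
      rw [map_add, ← hcomm]
      change S.mkQ (t, 0) + S.mkQ (0, f x) = _
      rw [← map_add]
      simp
    · rintro ⟨s, hs⟩
      rw [← hs]
      change g 0 = 0
      simp
  have hse : IsShortExact R f' g' := by
    refine ⟨?_, fun w => ?_, hex⟩
    · refine (injective_iff_map_eq_zero f').2 fun t ht => ?_
      obtain ⟨x, hx⟩ := (Submodule.Quotient.mk_eq_zero S).1 ht
      have h1 : u x = t := congrArg Prod.fst hx
      have h2 : -f x = 0 := congrArg Prod.snd hx
      have h3 : x = 0 := hf (by simpa using h2)
      rw [← h1, h3, map_zero]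
    · obtain ⟨v, rfl⟩ := hg w
      exact ⟨S.mkQ (0, v), rfl⟩
  obtain ⟨n, i, p, hpi⟩ := hW
  choose s hs using fun k => exists_lift_of_rigid hT hse (p.comp (LinearMap.single R (fun _ => T) k))
  let l : W →ₗ[R] (T × V) ⧸ S := (LinearMap.lsum R (fun _ : Fin n => T) ℕ s).comp i
  have hl : g'.comp l = LinearMap.id := by
    have h1 : g'.comp (LinearMap.lsum R (fun _ : Fin n => T) ℕ s) = p := by
      refine LinearMap.pi_ext' fun k => ?_
      rw [← hs k]
      refine LinearMap.ext fun t => ?_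
      simp [LinearMap.lsum_apply, Pi.single_apply, Finset.sum_apply, apply_ite]
    rw [← LinearMap.comp_assoc, h1, hpi]
  obtain ⟨-, r, hr⟩ := (hex.split_tfae'.out 0 1 rfl rfl).1 ⟨hse.1, l, hl⟩
  refine ⟨r.comp (S.mkQ.comp (LinearMap.inr R T V)), LinearMap.ext fun x => ?_⟩
  have := LinearMap.congr_fun hr (u x)
  change r (S.mkQ (0, f x)) = u x
  rw [hcomm]
  exact this

/-- If `T` has projective dimension at most one, then the kernel of every epimorphism onto `T`
from a projective module is projective. -/
lemma projective_ker_of_pdim_le_one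
    {P₁ P₀ : Type} [AddCommGroup P₁] [Module R P₁] [AddCommGroup P₀] [Module R P₀]
    {f : P₁ →ₗ[R] P₀} {g : P₀ →ₗ[R] T} [Module.Projective R P₁] [Module.Projective R P₀]
    (h : IsShortExact R f g) {F : Type} [AddCommGroup F] [Module R F] [Module.Projective R F]
    (q : F →ₗ[R] T) (hq : Surjective q) : Module.Projective R (LinearMap.ker q) := by
  obtain ⟨hf, hg, hfg⟩ := h
  obtain ⟨σ, hσ⟩ := Module.projective_lifting_property g q hg
  obtain ⟨τ, hτ⟩ := Module.projective_lifting_property q g hq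
  have hσ' : ∀ y, g (σ y) = q y := LinearMap.congr_fun hσ
  have hτ' : ∀ y, q (τ y) = g y := LinearMap.congr_fun hτ
  let e : P₁ ≃ₗ[R] LinearMap.ker g :=
    (LinearEquiv.ofInjective f hf).trans (LinearEquiv.ofEq _ _ (LinearMap.exact_iff.1 hfg).symm)
  have he : ∀ z, f (e.symm z) = z := fun z => by
    obtain ⟨x, rfl⟩ := e.surjective z
    rw [e.symm_apply_apply]
    rfl
  let σ' : LinearMap.ker q →ₗ[R] LinearMap.ker g :=
    (σ.comp (LinearMap.ker q).subtype).codRestrict _ (fun w => by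
      simp [hσ'])
  let a : LinearMap.ker q →ₗ[R] P₁ × F :=
    LinearMap.prod (e.symm.toLinearMap.comp σ') (LinearMap.ker q).subtype
  let b : P₁ × F →ₗ[R] LinearMap.ker q :=
    LinearMap.codRestrict _ (LinearMap.coprod (τ.comp f) (LinearMap.id - τ.comp σ)) (fun z => by
      simp [hτ', hσ', hfg.apply_apply_eq_zero])
  refine Module.Projective.of_split a b (LinearMap.ext fun w => Subtype.ext ?_)
  change τ (f (e.symm (σ' w))) + ((w : F) - τ (σ w)) = w
  rw [he]
  change τ (σ w) + ((w : F) - τ (σ w)) = w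
  abel

/-- A special tilting module is generated by `P`. -/
lemma IsSpecialTilting.exists_map_eq {P : Type} [AddCommGroup P] [Module R P]
    (hT : IsSpecialTilting R P T) (t : T) :
    ∃ (n : ℕ) (h : (Fin n → P) →ₗ[R] T) (y : Fin n → P), h y = t := by
  obtain ⟨T₀, T₁, _, _, _, _, f, g, ⟨n, i, p, hpi⟩, h₁, hse⟩ := hT.coresolves_special
  obtain ⟨v, hv⟩ := exists_extension_of_rigid hT.isTilting.rigid h₁ hse
    (LinearMap.toSpanSingleton R T t)
  refine ⟨n, v.comp p, i (f 1), ?_⟩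
  have h1 : p (i (f 1)) = f 1 := LinearMap.congr_fun hpi _
  have h2 : v (f 1) = (1 : R) • t := LinearMap.congr_fun hv 1
  rw [LinearMap.comp_apply, h1, h2, one_smul]

end Extensions

section Uniqueness

variable {A B : Type} [Ring A] [Ring B] {e : B}

/-- An intermediate extension along a corner map that is onto `eBe` is unique up to
isomorphism. -/
lemma IsIntermediateExtension.nonempty_linearEquiv (φ : CornerMap A B e)
    (hφ : ∀ b : B, e * b = b → b * e = b → ∃ a : A, φ.toHom a = b)
    {M : Type} [AddCommGroup M] [Module A M]
    {Y Y' : Type} [AddCommGroup Y] [Module B Y] [AddCommGroup Y'] [Module B Y']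
    (hY : IsIntermediateExtension φ M Y) (hY' : IsIntermediateExtension φ M Y') :
    Nonempty (Y ≃ₗ[B] Y') := by
  obtain ⟨hc, hs, ⟨θ₁⟩⟩ := hY
  obtain ⟨hc', hs', ⟨θ₂⟩⟩ := hY'
  let θ : ePart φ Y ≃ₗ[A] ePart φ Y' := θ₁.trans θ₂.symm
  have hee : e * e = e := by
    have := φ.map_mul 1 1
    rw [mul_one, φ.map_one] at this
    exact this.symm
  let cut : Y → ePart φ Y := fun y => ⟨e • y, by rw [← mul_smul, hee]⟩
  have cut_add : ∀ y z, cut (y + z) = cut y + cut z := fun y z => Subtype.ext (smul_add _ _ _)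
  have cut_zero : cut 0 = 0 := Subtype.ext (smul_zero _)
  let Z : Submodule B (Y × Y') :=
    Submodule.span B (Set.range fun y : ePart φ Y => (y.val, (θ y).val))
  have key : ∀ z ∈ Z, ∀ b : B, (θ (cut (b • z.1))).val = e • b • z.2 := by
    intro z hz
    refine Submodule.span_induction (p := fun z _ => ∀ b : B,
      (θ (cut (b • z.1))).val = e • b • z.2) ?_ ?_ ?_ ?_ hz
    · rintro _ ⟨y, rfl⟩ b
      obtain ⟨a, ha⟩ := hφ (e * b * e) (by simp only [← mul_assoc, hee])
        (by simp only [mul_assoc, hee])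
      have h1 : cut (b • y.val) = a • y := by
        refine Subtype.ext ?_
        change e • b • y.val = φ.toHom a • y.val
        rw [ha, mul_smul, mul_smul, y.prop]
      rw [h1, map_smul, ePart.smul_def, ha, mul_smul, mul_smul, (θ y).prop]
    · intro b
      change (θ (cut (b • (0 : Y)))).val = e • b • (0 : Y')
      rw [smul_zero, smul_zero, smul_zero, cut_zero, map_zero]
      rfl
    · intro z w _ _ h1 h2 b
      change (θ (cut (b • (z.1 + w.1)))).val = e • b • (z.2 + w.2)
      rw [smul_add, smul_add, smul_add, cut_add, map_add, ← h1, ← h2]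
      rfl
    · intro c z _ h1 b
      change (θ (cut (b • c • z.1))).val = e • b • c • z.2
      rw [← mul_smul, h1, mul_smul]
  let f₁ : Z →ₗ[B] Y := (LinearMap.fst B Y Y').comp Z.subtype
  let f₂ : Z →ₗ[B] Y' := (LinearMap.snd B Y Y').comp Z.subtype
  have hf₁ : Bijective f₁ := by
    constructor
    · refine (injective_iff_map_eq_zero f₁).2 fun z hz => ?_
      have h1 : z.1.1 = 0 := hz
      refine Subtype.ext (Prod.ext h1 (hs' _ fun b => ?_))
      rw [← key z.1 z.2 b, h1, smul_zero, cut_zero, map_zero]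
      rfl
    · refine LinearMap.range_eq_top.1 (top_le_iff.1 (hc.trans (Submodule.span_le.2 ?_)))
      rintro _ ⟨w, rfl⟩
      exact ⟨⟨_, Submodule.subset_span ⟨cut w, rfl⟩⟩, rfl⟩
  have hf₂ : Bijective f₂ := by
    constructor
    · refine (injective_iff_map_eq_zero f₂).2 fun z hz => ?_
      have h1 : z.1.2 = 0 := hz
      refine Subtype.ext (Prod.ext (hs _ fun b => ?_) h1)
      have h2 := key z.1 z.2 b
      rw [h1, smul_zero, smul_zero] at h2
      have h3 : θ (cut (b • z.1.1)) = 0 := Subtype.ext h2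
      exact congrArg (ePart.val φ Y) ((map_eq_zero_iff θ θ.injective).1 h3)
    · refine LinearMap.range_eq_top.1 (top_le_iff.1 (hc'.trans (Submodule.span_le.2 ?_)))
      rintro _ ⟨w, rfl⟩
      let w' : ePart φ Y' := ⟨e • w, by rw [← mul_smul, hee]⟩
      refine ⟨⟨_, Submodule.subset_span ⟨θ.symm w', rfl⟩⟩, ?_⟩
      change (θ (θ.symm w')).val = e • w
      rw [θ.apply_symm_apply]
      rfl
  exact ⟨(LinearEquiv.ofBijective f₁ hf₁).symm.trans (LinearEquiv.ofBijective f₂ hf₂)⟩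

end Uniqueness

section Duality

variable {K A : Type} [Field K] [Ring A] [Algebra K A]
variable {E : Type} [AddCommGroup E] [Module A E] [Module K E] [IsScalarTower K A E]

instance ModuleDual.isScalarTower : IsScalarTower K (Module.End A E)ᵐᵒᵖ (ModuleDual K A E) where
  smul_assoc k γ f := LinearMap.ext fun x => by
    change ModuleDual.toLin K A E f (k • γ.unop x) = k • ModuleDual.toLin K A E f (γ.unop x)
    rw [map_smul]

/-- Unfold a `CornerDual` element to a linear map. -/
def CornerDual.toLin {B : Type} [Ring B] [Algebra K B] {e : B} (f : CornerDual B K e) :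
    rightCornerSubspace B K e →ₗ[K] K := f

instance CornerDual.isScalarTower {B : Type} [Ring B] [Algebra K B] (e : B) :
    IsScalarTower K B (CornerDual B K e) where
  smul_assoc k b f := LinearMap.ext fun x => by
    change f.toLin (CornerDual.rmul B K e (k • b) x) = k • f.toLin (CornerDual.rmul B K e b x)
    rw [← map_smul]
    exact congrArg _ (Subtype.ext (mul_smul_comm k (x : B) b))

lemma ModuleDual.ext_toLin {f g : ModuleDual K A E}
    (h : ∀ x, ModuleDual.toLin K A E f x = ModuleDual.toLin K A E g x) : f = g :=
  LinearMap.ext h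

lemma ModuleDual.toLin_smul (γ : (Module.End A E)ᵐᵒᵖ) (f : ModuleDual K A E) (x : E) :
    ModuleDual.toLin K A E (γ • f) x = ModuleDual.toLin K A E f (γ.unop x) := rfl

lemma toLin_dualAct (a : A) (f : ModuleDual K A E) (x : E) :
    ModuleDual.toLin K A E (dualAct K A E a f) x = ModuleDual.toLin K A E f (a • x) := rfl

lemma dualAct_algebraMap (k : K) (f : ModuleDual K A E) :
    dualAct K A E (algebraMap K A k) f = k • f :=
  ModuleDual.ext_toLin fun x => by
    rw [toLin_dualAct, algebraMap_smul, map_smul]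
    rfl

/-- Elements of `D E` separate points of `E`. -/
lemma eq_of_forall_toLin_eq {x y : E}
    (h : ∀ f : ModuleDual K A E, ModuleDual.toLin K A E f x = ModuleDual.toLin K A E f y) :
    x = y :=
  (Module.forall_dual_apply_eq_zero_iff K (x - y)).1 (fun f => by
    rw [map_sub, sub_eq_zero]; exact h f) |> sub_eq_zero.1

/-- A cogenerator is faithful. -/
lemma dualAct_injective [FiniteDimensional K A] (hE : IsCogenerator A E) :
    Injective (dualAct K A E) := by
  intro a b hab
  obtain ⟨n, j, hj⟩ := hE A inferInstance
  have h : ∀ x : E, a • x = b • x := fun x => eq_of_forall_toLin_eq (K := K) (A := A) fun f => by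
    rw [← toLin_dualAct, hab, toLin_dualAct]
  have h1 : j (a • 1) = j (b • 1) := by
    rw [map_smul, map_smul]
    funext k
    exact h _
  simpa using hj h1

/-- An element of `Γⁿ`, for `Γ = End_A(E)ᵒᵖ`, killed by every map to `D E` vanishes. -/
lemma eq_zero_of_forall_map_pi_eq_zero {n : ℕ} {q : Fin n → (Module.End A E)ᵐᵒᵖ}
    (hq : ∀ h : (Fin n → (Module.End A E)ᵐᵒᵖ) →ₗ[(Module.End A E)ᵐᵒᵖ] ModuleDual K A E,
      h q = 0) : q = 0 := by
  funext k
  refine MulOpposite.unop_injective (LinearMap.ext fun x => ?_)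
  refine eq_of_forall_toLin_eq (K := K) (A := A) fun f => ?_
  have := hq ((LinearMap.toSpanSingleton _ _ f).comp (LinearMap.proj k))
  have h1 : q k • f = 0 := this
  have h2 := congrArg (fun g => ModuleDual.toLin K A E g x) h1
  rw [Pi.zero_apply, MulOpposite.unop_zero, LinearMap.zero_apply, map_zero]
  exact h2

instance finiteDimensional_end [FiniteDimensional K E] :
    FiniteDimensional K (Module.End A E)ᵐᵒᵖ := by
  have : FiniteDimensional K (Module.End A E) :=
    Module.Finite.of_injective (LinearMap.restrictScalarsₗ K A E E K)
      (LinearMap.restrictScalars_injective K)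
  exact Module.Finite.equiv (MulOpposite.opLinearEquiv K)

variable [FiniteDimensional K E]

/-- A `K`-linear functional on `D E` is evaluation at an element of `E`. -/
lemma exists_toLin_eq (u : ModuleDual K A E →ₗ[K] K) :
    ∃ x : E, ∀ f, u f = ModuleDual.toLin K A E f x := by
  obtain ⟨x, hx⟩ := (Module.evalEquiv K E).surjective u
  exact ⟨x, fun f => (LinearMap.congr_fun hx f).symm⟩

/-- A `K`-linear endomorphism of `D E` is the transpose of an endomorphism of `E`. -/
lemma exists_transpose (v : ModuleDual K A E →ₗ[K] ModuleDual K A E) :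
    ∃ u : E →ₗ[K] E, ∀ f x, ModuleDual.toLin K A E (v f) x = ModuleDual.toLin K A E f (u x) := by
  have h : ∀ x : E, ∃ y : E, ∀ f : ModuleDual K A E,
      ModuleDual.toLin K A E (v f) x = ModuleDual.toLin K A E f y := fun x =>
    exists_toLin_eq ((LinearMap.applyₗ x : (E →ₗ[K] K) →ₗ[K] K).comp v)
  choose u hu using h
  refine ⟨⟨⟨u, fun x y => ?_⟩, fun k x => ?_⟩, fun f x => hu x f⟩
  · refine eq_of_forall_toLin_eq (K := K) (A := A) fun f => ?_
    rw [map_add, ← hu, ← hu, ← hu, map_add]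
  · refine eq_of_forall_toLin_eq (K := K) (A := A) fun f => ?_
    rw [RingHom.id_apply, map_smul, ← hu, ← hu, map_smul]

/-- An additive endomorphism of `D E` commuting with the action of `A` is given by the action of
an element of `End_A(E)ᵒᵖ`. -/
lemma exists_smul_of_commute_dualAct (v : ModuleDual K A E →+ ModuleDual K A E)
    (hv : ∀ a f, v (dualAct K A E a f) = dualAct K A E a (v f)) :
    ∃ γ : (Module.End A E)ᵐᵒᵖ, ∀ f, v f = γ • f := by
  obtain ⟨u, hu⟩ := exists_transpose (A := A) ({ v with
    map_smul' := fun k f => by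
      change v (k • f) = k • v f
      rw [← dualAct_algebraMap, hv, dualAct_algebraMap] } :
    ModuleDual K A E →ₗ[K] ModuleDual K A E)
  replace hu : ∀ f x, ModuleDual.toLin K A E (v f) x = ModuleDual.toLin K A E f (u x) := hu
  refine ⟨MulOpposite.op ⟨⟨u, u.map_add⟩, fun a x => ?_⟩, fun f =>
    ModuleDual.ext_toLin fun x => hu f x⟩
  refine eq_of_forall_toLin_eq (K := K) (A := A) fun f => ?_
  change ModuleDual.toLin K A E f (u (a • x)) = ModuleDual.toLin K A E f (a • u x)
  rw [← hu, ← toLin_dualAct, ← toLin_dualAct, ← hv, hu]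

/-- A cogenerator has the double centralizer property: every `End_A(E)ᵒᵖ`-endomorphism of `D E`
is given by the action of an element of `A`. -/
lemma exists_dualAct_eq [FiniteDimensional K A] (hE : IsCogenerator A E)
    (u : ModuleDual K A E →ₗ[(Module.End A E)ᵐᵒᵖ] ModuleDual K A E) :
    ∃ a : A, dualAct K A E a = u := by
  obtain ⟨v, hv⟩ := exists_transpose (u.restrictScalars K)
  replace hv : ∀ f x, ModuleDual.toLin K A E (u f) x = ModuleDual.toLin K A E f (v x) := hv
  have hcomm : ∀ (γ : Module.End A E) (x : E), v (γ x) = γ (v x) := fun γ x => by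
    refine eq_of_forall_toLin_eq (K := K) (A := A) fun f => ?_
    have h1 := congrArg (fun g => ModuleDual.toLin K A E g x) (u.map_smul (MulOpposite.op γ) f)
    simp only [ModuleDual.toLin_smul, hv, MulOpposite.unop_op] at h1
    exact h1.symm
  obtain ⟨n, s, hs⟩ := Module.Finite.exists_fin (R := K) (M := E)
  have : Module.Finite A E := Module.Finite.of_restrictScalars_finite K A E
  obtain ⟨m, j, hj⟩ := hE ((Fin n → E) ⧸ Submodule.span A {s}) inferInstance
  have hmem : (fun k => v (s k)) ∈ Submodule.span A {s} := by
    refine (Submodule.Quotient.mk_eq_zero _).1 (hj ?_)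
    rw [map_zero]
    funext l
    let c : Fin n → Module.End A E := fun k =>
      (LinearMap.proj l).comp (j.comp ((Submodule.mkQ _).comp (LinearMap.single A (fun _ => E) k)))
    have hc : ∀ z : Fin n → E, j (Submodule.Quotient.mk z) l = ∑ k, c k (z k) := fun z => by
      conv_lhs => rw [← Finset.univ_sum_single z]
      change ((LinearMap.proj l).comp (j.comp (Submodule.mkQ _)) :
        (Fin n → E) →ₗ[A] E) _ = _
      rw [map_sum]
      rfl
    have h0 : ∑ k, c k (s k) = 0 := by
      rw [← hc, (Submodule.Quotient.mk_eq_zero _).2 (Submodule.mem_span_singleton_self s), map_zero]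
      rfl
    rw [hc]
    simp only [← hcomm]
    rw [← map_sum, h0, map_zero]
    rfl
  obtain ⟨a, ha⟩ := Submodule.mem_span_singleton.1 hmem
  refine ⟨a, LinearMap.ext fun f => ModuleDual.ext_toLin fun x => ?_⟩
  have hva : smulKLin K A E a = v := by
    refine LinearMap.ext_on_range hs fun k => ?_
    exact congrFun ha k
  rw [toLin_dualAct, hv, ← hva]
  rfl

/-- A family of elements of a finite-dimensional dual space without common zeros spans. -/
lemma mem_of_forall_eq_zero {V : Type} [AddCommGroup V] [Module K V] [FiniteDimensional K V]
    (S : Submodule K (Module.Dual K V)) (hS : ∀ x : V, (∀ f ∈ S, f x = 0) → x = 0)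
    (f : Module.Dual K V) : f ∈ S := by
  have h : S.dualCoannihilator = ⊥ :=
    (Submodule.eq_bot_iff _).2 fun x hx => hS x ((Submodule.mem_dualCoannihilator x).1 hx)
  rw [← Subspace.dualCoannihilator_dualAnnihilator_eq (W := S), h,
    Submodule.dualAnnihilator_bot]
  trivial

end Duality

section Torsionless

variable {K A : Type} [Field K] [Ring A] [Algebra K A]
variable {E : Type} [AddCommGroup E] [Module A E] [Module K E] [IsScalarTower K A E]
variable [FiniteDimensional K E]

/-- A finite-dimensional module `T` of projective dimension at most one over `End_A(E)ᵒᵖ` with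
`Ext¹(T, D E) = 0` is cogenerated by `D E`. -/
lemma eq_zero_of_forall_map_eq_zero
    {T : Type} [AddCommGroup T] [Module (Module.End A E)ᵐᵒᵖ T]
    [Module K T] [IsScalarTower K (Module.End A E)ᵐᵒᵖ T] [FiniteDimensional K T]
    (hT : IsTilting (Module.End A E)ᵐᵒᵖ T)
    (i₀ : ModuleDual K A E →ₗ[(Module.End A E)ᵐᵒᵖ] T)
    (p₀ : T →ₗ[(Module.End A E)ᵐᵒᵖ] ModuleDual K A E)
    (hsplit : p₀.comp i₀ = LinearMap.id) {t : T}
    (ht : ∀ h : T →ₗ[(Module.End A E)ᵐᵒᵖ] ModuleDual K A E, h t = 0) : t = 0 := by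
  have : Module.Finite (Module.End A E)ᵐᵒᵖ T :=
    Module.Finite.of_restrictScalars_finite K (Module.End A E)ᵐᵒᵖ T
  have : IsNoetherianRing (Module.End A E)ᵐᵒᵖ := isNoetherian_of_tower K inferInstance
  obtain ⟨n, π, hπ⟩ := Module.Finite.exists_fin' (Module.End A E)ᵐᵒᵖ T
  let Ω := LinearMap.ker π
  have hproj : Module.Projective (Module.End A E)ᵐᵒᵖ Ω := by
    obtain ⟨P₁, P₀, _, _, _, _, f, g, hP₁, hP₀, hse⟩ := hT.pdim_le_one
    exact projective_ker_of_pdim_le_one hse π hπ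
  have hse : IsShortExact (Module.End A E)ᵐᵒᵖ Ω.subtype π :=
    ⟨Subtype.val_injective, hπ, LinearMap.exact_subtype_ker_map π⟩
  have hadd : InAdd (Module.End A E)ᵐᵒᵖ T T :=
    ⟨1, LinearMap.pi fun _ => LinearMap.id, LinearMap.proj 0, rfl⟩
  have hext : ∀ h : Ω →ₗ[(Module.End A E)ᵐᵒᵖ] ModuleDual K A E,
      ∃ h' : (Fin n → (Module.End A E)ᵐᵒᵖ) →ₗ[(Module.End A E)ᵐᵒᵖ] ModuleDual K A E,
        h'.comp Ω.subtype = h := fun h => by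
    obtain ⟨v, hv⟩ := exists_extension_of_rigid hT.rigid hadd hse (i₀.comp h)
    refine ⟨p₀.comp v, ?_⟩
    rw [LinearMap.comp_assoc, hv, ← LinearMap.comp_assoc, hsplit, LinearMap.id_comp]
  choose ext hext using hext
  obtain ⟨q, rfl⟩ := hπ t
  have hwd : ∀ d : (Fin n → (Module.End A E)ᵐᵒᵖ) →ₗ[(Module.End A E)ᵐᵒᵖ] ModuleDual K A E,
      (∀ w : Ω, d w = 0) → d q = 0 := fun d hd => by
    let d' : T →ₗ[(Module.End A E)ᵐᵒᵖ] ModuleDual K A E :=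
      (Ω.liftQ d fun w hw => hd ⟨w, hw⟩).comp
        (π.quotKerEquivOfSurjective hπ).symm.toLinearMap
    have h1 : d' (π q) = d q := by
      have h2 : (π.quotKerEquivOfSurjective hπ).symm (π q) = Submodule.Quotient.mk q := by
        rw [LinearEquiv.symm_apply_eq]
        rfl
      change (Ω.liftQ d fun w hw => hd ⟨w, hw⟩) ((π.quotKerEquivOfSurjective hπ).symm (π q)) = _
      rw [h2]
      rfl
    rw [← h1, ht]
  have hext' : ∀ (h : Ω →ₗ[(Module.End A E)ᵐᵒᵖ] ModuleDual K A E)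
      (g : (Fin n → (Module.End A E)ᵐᵒᵖ) →ₗ[(Module.End A E)ᵐᵒᵖ] ModuleDual K A E),
      (∀ w : Ω, g w = h w) → g q = ext h q := fun h g hg => by
    rw [← sub_eq_zero, ← LinearMap.sub_apply]
    refine hwd _ fun w => ?_
    rw [LinearMap.sub_apply, hg, sub_eq_zero]
    exact (LinearMap.congr_fun (hext h) w).symm
  have hval : ∀ (h : Ω →ₗ[(Module.End A E)ᵐᵒᵖ] ModuleDual K A E) (w : Ω), ext h w = h w :=
    fun h w => LinearMap.congr_fun (hext h) w
  obtain ⟨m, ρ, c, -, -, hρc⟩ :=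
    Module.Finite.exists_comp_eq_id_of_projective (Module.End A E)ᵐᵒᵖ Ω
  let R : Fin m → ModuleDual K A E → Ω →ₗ[(Module.End A E)ᵐᵒᵖ] ModuleDual K A E := fun k f =>
    (LinearMap.toSpanSingleton _ _ f).comp ((LinearMap.proj k).comp c)
  have hR : ∀ k f w, R k f w = c w k • f := fun k f w => rfl
  let v : Fin m → ModuleDual K A E →+ ModuleDual K A E := fun k =>
    AddMonoidHom.mk' (fun f => ext (R k f) q) fun f g => by
      rw [← LinearMap.add_apply]
      refine (hext' _ _ fun w => ?_).symm
      rw [LinearMap.add_apply, hval, hval, hR, hR, hR, smul_add]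
  have hv : ∀ k, ∃ γ : (Module.End A E)ᵐᵒᵖ, ∀ f, v k f = γ • f := fun k =>
    exists_smul_of_commute_dualAct (v k) fun a f => by
      refine (hext' _ ((dualAct K A E a).comp (ext (R k f))) fun w => ?_).symm
      rw [LinearMap.comp_apply, hval, hR, hR, map_smul]
  choose γ hγ using hv
  let b : Fin m → Ω := fun k => ρ (Pi.single k 1)
  have hb : ∀ w : Ω, w = ∑ k, c w k • b k := fun w => by
    have h1 : ρ (c w) = w := LinearMap.congr_fun hρc w
    conv_lhs => rw [← h1, pi_eq_sum_univ' (c w), map_sum]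
    refine Finset.sum_congr rfl fun k _ => ?_
    rw [map_smul]
  let w₀ : Ω := ∑ k, γ k • b k
  have hq : q - w₀ = 0 := eq_zero_of_forall_map_pi_eq_zero (K := K) fun h => by
    have h1 : h q = ∑ k, ext (R k (h (b k))) q := by
      rw [← LinearMap.sum_apply]
      have h2 : ∀ g : (Fin n → (Module.End A E)ᵐᵒᵖ) →ₗ[(Module.End A E)ᵐᵒᵖ] ModuleDual K A E,
          (∀ w : Ω, g w = h w) → h q = g q := fun g hg => by
        rw [hext' (h.comp Ω.subtype) h fun _ => rfl, hext' (h.comp Ω.subtype) g hg]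
      refine h2 _ fun w => ?_
      rw [LinearMap.sum_apply]
      have h3 := congrArg (h.comp Ω.subtype) (hb w)
      rw [map_sum] at h3
      refine Eq.trans (Finset.sum_congr rfl fun k _ => ?_) h3.symm
      rw [hval, hR, map_smul]
      rfl
    have h4 : h w₀ = ∑ k, γ k • h (b k) := by
      have := map_sum (h.comp Ω.subtype) (fun k => γ k • b k) Finset.univ
      refine Eq.trans this (Finset.sum_congr rfl fun k _ => ?_)
      rw [map_smul]
      rfl
    rw [map_sub, sub_eq_zero, h1, h4]
    exact Finset.sum_congr rfl fun k _ => hγ k _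
  rw [sub_eq_zero.1 hq]
  exact w₀.2

end Torsionless

section CogeneratorTilted

variable {K A : Type} [Field K] [Ring A] [Algebra K A]
variable {E : Type} [AddCommGroup E] [Module A E] [Module K E] [IsScalarTower K A E]
variable {T : Type} [AddCommGroup T] [Module (Module.End A E)ᵐᵒᵖ T]
variable {i₀ : ModuleDual K A E →ₗ[(Module.End A E)ᵐᵒᵖ] T}
variable {p₀ : T →ₗ[(Module.End A E)ᵐᵒᵖ] ModuleDual K A E}

lemma canonicalCornerMap_apply (hsplit : p₀.comp i₀ = LinearMap.id) (a : A) :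
    (canonicalCornerMap K A E T i₀ p₀ hsplit).toHom a =
      MulOpposite.op ((i₀.comp (dualAct K A E a)).comp p₀) := rfl

lemma canonicalCornerMap_injective [FiniteDimensional K A] (hE : IsCogenerator A E)
    (hsplit : p₀.comp i₀ = LinearMap.id) :
    Injective (canonicalCornerMap K A E T i₀ p₀ hsplit).toHom := by
  intro a b hab
  refine dualAct_injective (K := K) hE (LinearMap.ext fun f => ?_)
  have hsp : ∀ z, p₀ (i₀ z) = z := LinearMap.congr_fun hsplit
  have h := congrArg p₀ (LinearMap.congr_fun (MulOpposite.op_injective hab) (i₀ f))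
  simpa [hsp] using h

lemma canonicalCornerMap_surjective [FiniteDimensional K A] [FiniteDimensional K E]
    (hE : IsCogenerator A E) (hsplit : p₀.comp i₀ = LinearMap.id)
    (b : (Module.End (Module.End A E)ᵐᵒᵖ T)ᵐᵒᵖ)
    (h₁ : MulOpposite.op (i₀.comp p₀) * b = b) (h₂ : b * MulOpposite.op (i₀.comp p₀) = b) :
    ∃ a : A, (canonicalCornerMap K A E T i₀ p₀ hsplit).toHom a = b := by
  obtain ⟨a, ha⟩ := exists_dualAct_eq hE (p₀.comp (b.unop.comp i₀))
  refine ⟨a, MulOpposite.unop_injective (LinearMap.ext fun t => ?_)⟩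
  have h₁' : ∀ t, b.unop (i₀ (p₀ t)) = b.unop t :=
    LinearMap.congr_fun (congrArg MulOpposite.unop h₁)
  have h₂' : ∀ t, i₀ (p₀ (b.unop t)) = b.unop t :=
    LinearMap.congr_fun (congrArg MulOpposite.unop h₂)
  change i₀ (dualAct K A E a (p₀ t)) = b.unop t
  rw [ha]
  change i₀ (p₀ (b.unop (i₀ (p₀ t)))) = b.unop t
  rw [h₂', h₁']

variable [Module K T] [IsScalarTower K (Module.End A E)ᵐᵒᵖ T]

lemma map_smul_of_isScalarTower {R M N : Type} [Ring R] [Algebra K R] [AddCommGroup M]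
    [Module R M] [Module K M] [IsScalarTower K R M] [AddCommGroup N] [Module R N] [Module K N]
    [IsScalarTower K R N] (f : M →ₗ[R] N) (k : K) (x : M) : f (k • x) = k • f x :=
  (f.restrictScalars K).map_smul k x

/-- The corner map is `K`-linear. -/
lemma canonicalCornerMap_smul (hsplit : p₀.comp i₀ = LinearMap.id) (k : K) (a : A) :
    (canonicalCornerMap K A E T i₀ p₀ hsplit).toHom (k • a) =
      k • (canonicalCornerMap K A E T i₀ p₀ hsplit).toHom a := by
  refine MulOpposite.unop_injective (LinearMap.ext fun t => ?_)
  change i₀ (dualAct K A E (k • a) (p₀ t)) = k • i₀ (dualAct K A E a (p₀ t))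
  rw [← map_smul_of_isScalarTower i₀]
  refine congrArg i₀ (ModuleDual.ext_toLin fun x => ?_)
  rw [toLin_dualAct, smul_assoc, map_smul]
  rfl

/-- `D T` is the intermediate extension of `E`. -/
lemma isIntermediateExtension_moduleDual [FiniteDimensional K E] [FiniteDimensional K T]
    (hT : IsSpecialTilting (Module.End A E)ᵐᵒᵖ (ModuleDual K A E) T)
    (hsplit : p₀.comp i₀ = LinearMap.id) :
    IsIntermediateExtension (canonicalCornerMap K A E T i₀ p₀ hsplit) E
      (ModuleDual K (Module.End A E)ᵐᵒᵖ T) := by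
  have hsp : ∀ z, p₀ (i₀ z) = z := LinearMap.congr_fun hsplit
  refine ⟨fun f _ => ?_, fun f hf => ?_, ?_⟩
  · let S := Submodule.span (Module.End (Module.End A E)ᵐᵒᵖ T)ᵐᵒᵖ
      {z : ModuleDual K (Module.End A E)ᵐᵒᵖ T | ∃ w, z = MulOpposite.op (i₀.comp p₀) • w}
    refine mem_of_forall_eq_zero (V := T) (S.restrictScalars K) (fun t ht => ?_) f
    refine eq_zero_of_forall_map_eq_zero hT.isTilting i₀ p₀ hsplit fun h => ?_
    refine ModuleDual.ext_toLin fun x => ?_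
    let w : ModuleDual K (Module.End A E)ᵐᵒᵖ T :=
      (LinearMap.applyₗ x : (E →ₗ[K] K) →ₗ[K] K).comp (p₀.restrictScalars K)
    have h1 := ht _ (S.smul_mem (MulOpposite.op (i₀.comp h)) (Submodule.subset_span ⟨w, rfl⟩))
    change ModuleDual.toLin K A E (p₀ (i₀ (p₀ (i₀ (h t))))) x = 0 at h1
    rw [hsp, hsp] at h1
    exact h1
  · refine LinearMap.ext fun t => ?_
    obtain ⟨n, h, y, rfl⟩ := hT.exists_map_eq t
    rw [← Finset.univ_sum_single y, map_sum]
    change ModuleDual.toLin K _ T f _ = 0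
    rw [map_sum]
    refine Finset.sum_eq_zero fun k _ => ?_
    have h1 := LinearMap.congr_fun
      (hf (MulOpposite.op ((h.comp (LinearMap.single _ (fun _ => ModuleDual K A E) k)).comp p₀)))
      (i₀ (y k))
    change ModuleDual.toLin K _ T f (h (Pi.single k (p₀ (i₀ (p₀ (i₀ (y k))))))) = 0 at h1
    rwa [hsp, hsp] at h1
  · let w : E → ModuleDual K (Module.End A E)ᵐᵒᵖ T := fun x =>
      (LinearMap.applyₗ x : (E →ₗ[K] K) →ₗ[K] K).comp (p₀.restrictScalars K)
    have hw : ∀ x t, ModuleDual.toLin K (Module.End A E)ᵐᵒᵖ T (w x) t =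
        ModuleDual.toLin K A E (p₀ t) x := fun _ _ => rfl
    let θ : E →ₗ[A] ePart (canonicalCornerMap K A E T i₀ p₀ hsplit)
        (ModuleDual K (Module.End A E)ᵐᵒᵖ T) :=
      { toFun := fun x => ⟨w x, ModuleDual.ext_toLin fun t => by
          change ModuleDual.toLin K A E (p₀ (i₀ (p₀ t))) x = _
          rw [hsp, hw]⟩
        map_add' := fun x y => Subtype.ext (ModuleDual.ext_toLin fun t => by
          change ModuleDual.toLin K A E (p₀ t) (x + y) =
            ModuleDual.toLin K A E (p₀ t) x + ModuleDual.toLin K A E (p₀ t) y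
          rw [map_add])
        map_smul' := fun a x => Subtype.ext (ModuleDual.ext_toLin fun t => by
          change ModuleDual.toLin K A E (p₀ t) (a • x) =
            ModuleDual.toLin K A E (p₀ (i₀ (dualAct K A E a (p₀ t)))) x
          rw [hsp, toLin_dualAct]) }
    have hθ : Bijective θ := by
      constructor
      · intro x y hxy
        refine eq_of_forall_toLin_eq (K := K) (A := A) fun f => ?_
        have h1 := congrArg (fun z => ModuleDual.toLin K (Module.End A E)ᵐᵒᵖ T
          (ePart.val _ _ z) (i₀ f)) hxy
        change ModuleDual.toLin K A E (p₀ (i₀ f)) x = ModuleDual.toLin K A E (p₀ (i₀ f)) y at h1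
        rwa [hsp] at h1
      · rintro ⟨f, hf⟩
        obtain ⟨x, hx⟩ := exists_toLin_eq (A := A)
          ((ModuleDual.toLin K (Module.End A E)ᵐᵒᵖ T f).comp (i₀.restrictScalars K))
        refine ⟨x, Subtype.ext (ModuleDual.ext_toLin fun t => ?_)⟩
        have h1 := LinearMap.congr_fun hf t
        change ModuleDual.toLin K A E (p₀ t) x = _
        rw [← hx]
        exact h1
    exact ⟨(LinearEquiv.ofBijective θ hθ).symm⟩

/-- `D(eB)` is the intermediate extension of `D A`. -/
lemma isIntermediateExtension_cornerDual [FiniteDimensional K A] [FiniteDimensional K E]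
    [FiniteDimensional K T] (hE : IsCogenerator A E)
    (hT : IsSpecialTilting (Module.End A E)ᵐᵒᵖ (ModuleDual K A E) T)
    (hsplit : p₀.comp i₀ = LinearMap.id) :
    IsIntermediateExtension (canonicalCornerMap K A E T i₀ p₀ hsplit) (RegularDual K A)
      (CornerDual (Module.End (Module.End A E)ᵐᵒᵖ T)ᵐᵒᵖ K (MulOpposite.op (i₀.comp p₀))) := by
  have hsp : ∀ z, p₀ (i₀ z) = z := LinearMap.congr_fun hsplit
  let B := (Module.End (Module.End A E)ᵐᵒᵖ T)ᵐᵒᵖ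
  let e : B := MulOpposite.op (i₀.comp p₀)
  let V := rightCornerSubspace B K e
  let φ := canonicalCornerMap K A E T i₀ p₀ hsplit
  have hee : e * e = e := by
    refine MulOpposite.unop_injective (LinearMap.ext fun t => ?_)
    change i₀ (p₀ (i₀ (p₀ t))) = i₀ (p₀ t)
    rw [hsp]
  have hsmul : ∀ (b : B) (f : CornerDual B K e) (x : V),
      (b • f).toLin x = f.toLin (CornerDual.rmul B K e b x) := fun _ _ _ => rfl
  refine ⟨fun f _ => ?_, fun f hf => ?_, ?_⟩
  · let S := Submodule.span B {z : CornerDual B K e | ∃ w, z = e • w}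
    refine mem_of_forall_eq_zero (V := V) (S.restrictScalars K) (fun x hx => ?_) f
    have h1 : ∀ b : B, CornerDual.rmul B K e e (CornerDual.rmul B K e b x) = 0 := fun b =>
      (Module.forall_dual_apply_eq_zero_iff K _).1 fun w =>
        hx _ (S.smul_mem b (Submodule.subset_span ⟨w, rfl⟩))
    refine Subtype.ext (MulOpposite.unop_injective (LinearMap.ext fun t => ?_))
    refine eq_zero_of_forall_map_eq_zero hT.isTilting i₀ p₀ hsplit fun h => ?_
    have h2 := LinearMap.congr_fun (congrArg (fun z : V => (z : B).unop)
      (h1 (MulOpposite.op (i₀.comp h)))) t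
    change i₀ (p₀ (i₀ (h ((x : B).unop t)))) = 0 at h2
    have h3 := congrArg p₀ h2
    rwa [hsp, hsp, map_zero] at h3
  · refine LinearMap.ext fun x => ?_
    have h1 : (e • (x : B) • f).toLin ⟨e, hee⟩ = 0 := by
      rw [hf]
      rfl
    rw [hsmul, hsmul] at h1
    refine Eq.trans (congrArg f.toLin (Subtype.ext ?_)) h1
    have h2 : e * (x : B) = x := x.2
    change (x : B) = e * e * x
    rw [hee, h2]
  · let j : A →ₗ[K] V :=
      { toFun := fun a => ⟨φ.toHom a, φ.mem_left a⟩
        map_add' := fun a b => Subtype.ext (map_add φ.toHom a b)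
        map_smul' := fun k a => Subtype.ext (canonicalCornerMap_smul hsplit k a) }
    have hj : Injective j := fun a b hab =>
      canonicalCornerMap_injective hE hsplit (congrArg Subtype.val hab)
    let θ : ePart φ (CornerDual B K e) →ₗ[A] RegularDual K A :=
      { toFun := fun f => (CornerDual.toLin (f.val)).comp j
        map_add' := fun f g => rfl
        map_smul' := fun a f => LinearMap.ext fun b =>
          congrArg (CornerDual.toLin f.val) (Subtype.ext (φ.map_mul b a).symm) }
    have hθ : Bijective θ := by
      constructor
      · refine (injective_iff_map_eq_zero θ).2 fun f hf => Subtype.ext (LinearMap.ext fun x => ?_)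
        have hx : e * (x : B) = x := x.2
        obtain ⟨a, ha⟩ := canonicalCornerMap_surjective hE hsplit ((x : B) * e)
          (by rw [← mul_assoc]; exact congrArg (· * e) hx) (by rw [mul_assoc]; exact congrArg _ hee)
        have h1 : (e • f.val).toLin x = f.val.toLin x := by rw [f.prop]
        have h2 : CornerDual.rmul B K e e x = j a := Subtype.ext ha.symm
        change f.val.toLin x = 0
        rw [← h1, hsmul, h2]
        exact LinearMap.congr_fun hf a
      · intro g
        obtain ⟨l, hl⟩ := LinearMap.exists_leftInverse_of_injective j (LinearMap.ker_eq_bot.2 hj)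
        let f : CornerDual B K e := ((RegularDual.toLin K A g).comp l).comp (CornerDual.rmul B K e e)
        refine ⟨⟨f, LinearMap.ext fun x => ?_⟩, LinearMap.ext fun a => ?_⟩
        · refine congrArg ((RegularDual.toLin K A g).comp l) (Subtype.ext ?_)
          change (x : B) * e * e = x * e
          rw [mul_assoc, hee]
        · have h1 : CornerDual.rmul B K e e (j a) = j a := Subtype.ext (φ.mem_right a)
          have h2 : l (j a) = a := LinearMap.congr_fun hl a
          change RegularDual.toLin K A g (l (CornerDual.rmul B K e e (j a))) = _
          rw [h1, h2]
          rfl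
    exact ⟨LinearEquiv.ofBijective θ hθ⟩

end CogeneratorTilted

/-- For an idempotent `e`, every module isomorphic to `D(eB)` is injective. -/
lemma CornerDual.injective_of_linearEquiv {K B : Type} [Field K] [Ring B] [Algebra K B] {e : B}
    (he : e * e = e) {Y : Type} [AddCommGroup Y] [Module B Y] (θ : Y ≃ₗ[B] CornerDual B K e) :
    Module.Injective B Y where
  out M N _ _ _ _ i hi g := by
    let _ : Module K M := Module.compHom M (algebraMap K B)
    let _ : Module K N := Module.compHom N (algebraMap K B)
    have : IsScalarTower K B M := ⟨fun k b m => by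
      rw [Algebra.smul_def, mul_smul]; rfl⟩
    have : IsScalarTower K B N := ⟨fun k b m => by
      rw [Algebra.smul_def, mul_smul]; rfl⟩
    let g' : M →ₗ[B] CornerDual B K e := θ.toLinearMap.comp g
    let ε : CornerDual B K e →ₗ[K] K := LinearMap.applyₗ (⟨e, he⟩ : rightCornerSubspace B K e)
    obtain ⟨l, hl⟩ := LinearMap.exists_leftInverse_of_injective (i.restrictScalars K)
      (LinearMap.ker_eq_bot.2 hi)
    let γ : N →ₗ[K] K := (ε.comp (g'.restrictScalars K)).comp l
    have hγ : ∀ m, γ (i m) = (g' m).toLin ⟨e, he⟩ := fun m => by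
      have h1 : l (i m) = m := LinearMap.congr_fun hl m
      change (g' (l (i m))).toLin ⟨e, he⟩ = _
      rw [h1]
    let h : N →ₗ[B] CornerDual B K e :=
      { toFun := fun y => ({
          toFun := fun x => γ ((x : B) • y)
          map_add' := fun x x' => by
            rw [Submodule.coe_add, add_smul, map_add]
          map_smul' := fun k x => by
            rw [Submodule.coe_smul, smul_assoc, map_smul, RingHom.id_apply] } :
            rightCornerSubspace B K e →ₗ[K] K)
        map_add' := fun y y' => LinearMap.ext fun x => by
          change γ ((x : B) • (y + y')) = γ ((x : B) • y) + γ ((x : B) • y')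
          rw [smul_add, map_add]
        map_smul' := fun b y => LinearMap.ext fun x => by
          change γ ((x : B) • b • y) = γ (((x : B) * b) • y)
          rw [mul_smul] }
    refine ⟨θ.symm.toLinearMap.comp h, fun m => θ.injective ?_⟩
    change θ (θ.symm (h (i m))) = g' m
    rw [θ.apply_symm_apply]
    refine LinearMap.ext fun x => ?_
    change γ ((x : B) • i m) = (g' m).toLin x
    rw [← map_smul, hγ, map_smul]
    exact congrArg (g' m).toLin (Subtype.ext x.2)

end GenFinitePaper

namespace GenFinitePaper

/-- Let `A` be a finite-dimensional `K`-algebra, `E` a basic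
finite-dimensional cogenerating `A`-module, `Γ = End_A(E)ᵒᵖ`, `P = D E`, and let
`B = End_Γ(T_P)ᵒᵖ` be the cogenerator-tilted algebra of `E` (where `T_P` is the unique
basic `P`-special tilting `Γ`-module), with special idempotent `e` given by projection
onto the summand `P` of `T_P`, and `c : mod A → mod B` the corresponding intermediate
extension functor (characterised on objects by `IsIntermediateExtension`).  Then
`c(E) ≅ D T_P` and `c(DA) ≅ D(eB)`; in particular `c(DA)` is an injective `B`-module. -/
theorem intermediate_extension_of_cogenerator_tilted_algebra
    (K A : Type) [Field K] [Ring A] [Algebra K A] [FiniteDimensional K A]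
    (E : Type) [AddCommGroup E] [Module A E] [Module K E] [IsScalarTower K A E]
    [FiniteDimensional K E]
    (hEbasic : IsBasic A E) (hEcogen : IsCogenerator A E)
    -- `T` is the basic `P`-special tilting module over `Γ = End_A(E)ᵒᵖ`
    (T : Type) [AddCommGroup T] [Module (Module.End A E)ᵐᵒᵖ T]
    [Module K T] [IsScalarTower K (Module.End A E)ᵐᵒᵖ T] [FiniteDimensional K T]
    (hT : IsSpecialTilting (Module.End A E)ᵐᵒᵖ (ModuleDual K A E) T)
    (hTbasic : IsBasic (Module.End A E)ᵐᵒᵖ T)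
    -- the summand data exhibiting `P = D E` as a direct summand of `T`, giving the
    -- special idempotent `e = op (i₀ ∘ p₀)` of `B = End_Γ(T)ᵒᵖ`
    (i₀ : ModuleDual K A E →ₗ[(Module.End A E)ᵐᵒᵖ] T)
    (p₀ : T →ₗ[(Module.End A E)ᵐᵒᵖ] ModuleDual K A E)
    (hsplit : p₀.comp i₀ = LinearMap.id) :
    -- `c(E) ≅ D T_P`
    (∀ (Y : Type) (_ : AddCommGroup Y)
        (_ : Module (Module.End (Module.End A E)ᵐᵒᵖ T)ᵐᵒᵖ Y),
      IsIntermediateExtension (canonicalCornerMap K A E T i₀ p₀ hsplit) E Y →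
        Nonempty (Y ≃ₗ[(Module.End (Module.End A E)ᵐᵒᵖ T)ᵐᵒᵖ]
          ModuleDual K (Module.End A E)ᵐᵒᵖ T)) ∧
    -- `c(D A) ≅ D(eB)`, and it is injective
    (∀ (Y : Type) (_ : AddCommGroup Y)
        (_ : Module (Module.End (Module.End A E)ᵐᵒᵖ T)ᵐᵒᵖ Y),
      IsIntermediateExtension (canonicalCornerMap K A E T i₀ p₀ hsplit)
          (RegularDual K A) Y →
        Nonempty (Y ≃ₗ[(Module.End (Module.End A E)ᵐᵒᵖ T)ᵐᵒᵖ]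
            CornerDual (Module.End (Module.End A E)ᵐᵒᵖ T)ᵐᵒᵖ K
              (MulOpposite.op (i₀.comp p₀))) ∧
          Module.Injective (Module.End (Module.End A E)ᵐᵒᵖ T)ᵐᵒᵖ Y) := by
  have hsurj := canonicalCornerMap_surjective (T := T) hEcogen hsplit
  refine ⟨fun Y _ _ hY => hY.nonempty_linearEquiv _ hsurj
    (isIntermediateExtension_moduleDual hT hsplit), fun Y _ _ hY => ?_⟩
  obtain ⟨θ⟩ := hY.nonempty_linearEquiv _ hsurj
    (isIntermediateExtension_cornerDual hEcogen hT hsplit)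
  refine ⟨⟨θ⟩, CornerDual.injective_of_linearEquiv (MulOpposite.unop_injective ?_) θ⟩
  refine LinearMap.ext fun t => congrArg i₀ ?_
  exact LinearMap.congr_fun hsplit (p₀ t)


end GenFinitePaper
end
end

section
/- Let Λ be a finite-dimensional K-algebra and let 0 → X → M ⊕ Z → Z → 0 be a short exact sequence of finite-dimensional Λ-modules. Then there exists a finite-dimensional Λ-module Z' ∈ gen(M) and a short exact sequence 0 → X → M ⊕ Z' → Z' → 0. -/
/- Preliminary notions: `add`, `gen`, `cogen`, generators and cogenerators,
short exact sequences, basic modules, indecomposability. -/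

noncomputable section

namespace GenFinitePaper

open Function

/-- If `Z = a(M) + b(Z)`, then every element of `Z` is a sum of elements `bⁱ (a mᵢ)` with `i < n`,
up to an element of the range of `bⁿ`. -/
theorem exists_sum_pow_apply_add {R M Z : Type} [Ring R] [AddCommGroup M] [Module R M]
    [AddCommGroup Z] [Module R Z] (a : M →ₗ[R] Z) (b : Module.End R Z)
    (h : ∀ z, ∃ m y, a m + b y = z) (n : ℕ) (z : Z) :
    ∃ (m : Fin n → M) (y : Z), ∑ i : Fin n, (b ^ (i : ℕ)) (a (m i)) + (b ^ n) y = z := by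
  induction n with
  | zero => exact ⟨Fin.elim0, z, by simp⟩
  | succ n ih =>
    obtain ⟨m, y, hy⟩ := ih
    obtain ⟨m', y', rfl⟩ := h y
    refine ⟨Fin.snoc m m', y', ?_⟩
    rw [← hy, Fin.sum_univ_castSucc]
    simp [pow_succ, add_assoc]

/-- Let `Λ` be a finite-dimensional `K`-algebra and
`0 → X → M ⊕ Z → Z → 0` a short exact sequence of finite-dimensional `Λ`-modules.  Then
there exists a finite-dimensional `Λ`-module `Z' ∈ gen M` and a short exact sequence
`0 → X → M ⊕ Z' → Z' → 0`. -/
theorem exists_degeneration_sequence_with_quotient_generated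
    (K Λ : Type) [Field K] [Ring Λ] [Algebra K Λ] [FiniteDimensional K Λ]
    (X M Z : Type) [AddCommGroup X] [Module Λ X] [AddCommGroup M] [Module Λ M]
    [AddCommGroup Z] [Module Λ Z]
    (hX : Module.Finite Λ X) (hM : Module.Finite Λ M) (hZ : Module.Finite Λ Z)
    (f : X →ₗ[Λ] M × Z) (g : M × Z →ₗ[Λ] Z) (hfg : IsShortExact Λ f g) :
    ∃ (Z' : Type) (_ : AddCommGroup Z') (_ : Module Λ Z'),
      Module.Finite Λ Z' ∧ InGen Λ M Z' ∧
      ∃ (f' : X →ₗ[Λ] M × Z') (g' : M × Z' →ₗ[Λ] Z'), IsShortExact Λ f' g' := by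
  have : IsArtinianRing Λ := isArtinian_of_tower K (inferInstance : IsArtinian K Λ)
  obtain ⟨hf, hg, hexact⟩ := hfg
  let a : M →ₗ[Λ] Z := g.comp (LinearMap.inl Λ M Z)
  let b : Module.End Λ Z := g.comp (LinearMap.inr Λ M Z)
  have hgab (m : M) (z : Z) : g (m, z) = a m + b z := by
    simp [a, b, ← map_add]
  have hab (z : Z) : ∃ m y, a m + b y = z := by
    obtain ⟨⟨m, y⟩, h⟩ := hg z
    exact ⟨m, y, (hgab m y).symm.trans h⟩
  obtain ⟨n, hcompl, hn⟩ :=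
    (b.eventually_isCompl_ker_pow_range_pow.and (Filter.eventually_ge_atTop 1)).exists
  obtain ⟨k, rfl⟩ := Nat.exists_eq_add_of_le' hn
  let I := LinearMap.range (b ^ (k + 1))
  have hI_stable : I ≤ I.comap b := by
    rintro _ ⟨y, rfl⟩
    exact ⟨b y, by rw [← Module.End.mul_apply, ← Module.End.mul_apply, ← pow_succ, ← pow_succ']⟩
  have hI_inj {z : Z} (hz : z ∈ I) (hbz : b z = 0) : z = 0 :=
    Submodule.disjoint_def.1 hcompl.disjoint z (by simp [pow_succ, hbz]) hz
  have hI_surj {z : Z} (hz : z ∈ I) : ∃ w ∈ I, b w = z := by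
    obtain ⟨y, rfl⟩ := hz
    obtain ⟨u, hu, _, ⟨w, rfl⟩, rfl⟩ := Submodule.mem_sup.1
      (hcompl.sup_eq_top ▸ Submodule.mem_top : y ∈ _ ⊔ _)
    refine ⟨(b ^ (k + 1)) ((b ^ k) w), ⟨_, rfl⟩, ?_⟩
    rw [map_add, LinearMap.mem_ker.1 hu, zero_add]
    simp only [← Module.End.mul_apply]
    congr 1
    rw [← pow_add, ← pow_succ', ← pow_add]
    congr 1
  let f' : X →ₗ[Λ] M × (Z ⧸ I) := (LinearMap.id.prodMap I.mkQ).comp f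
  let g' : M × (Z ⧸ I) →ₗ[Λ] Z ⧸ I := (I.mkQ.comp a).coprod (I.mapQ I b hI_stable)
  have hg' (m : M) (z : Z) : g' (m, I.mkQ z) = I.mkQ (g (m, z)) := by
    simp [g', hgab]
  refine ⟨Z ⧸ I, inferInstance, inferInstance, inferInstance, ?_, f', g', ?_, ?_, ?_⟩
  · refine ⟨k + 1, I.mkQ.comp (∑ i : Fin (k + 1), ((b ^ (i : ℕ)).comp a).comp
      (LinearMap.proj i)), fun z => ?_⟩
    obtain ⟨z, rfl⟩ := I.mkQ_surjective z
    obtain ⟨m, y, rfl⟩ := exists_sum_pow_apply_add a b hab (k + 1) z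
    have hy : I.mkQ ((b ^ (k + 1)) y) = 0 := (Submodule.Quotient.mk_eq_zero I).2 ⟨y, rfl⟩
    refine ⟨m, ?_⟩
    rw [map_add I.mkQ, hy, add_zero]
    simp
  · rw [injective_iff_map_eq_zero]
    intro x hx
    obtain ⟨hx₁, hx₂⟩ := Prod.ext_iff.1 hx
    have hfx₁ : (f x).1 = 0 := hx₁
    have hfx₂ : (f x).2 ∈ I := (Submodule.Quotient.mk_eq_zero I).1 hx₂
    have h : a (f x).1 + b (f x).2 = 0 := (hgab _ _).symm.trans (hexact.apply_apply_eq_zero x)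
    rw [hfx₁, map_zero, zero_add] at h
    exact (injective_iff_map_eq_zero f).1 hf x (Prod.ext hfx₁ (hI_inj hfx₂ h))
  · intro z
    obtain ⟨z, rfl⟩ := I.mkQ_surjective z
    obtain ⟨⟨m, y⟩, rfl⟩ := hg z
    exact ⟨(m, I.mkQ y), hg' m y⟩
  · rintro ⟨m, z⟩
    obtain ⟨z, rfl⟩ := I.mkQ_surjective z
    constructor
    · intro h
      rw [hg'] at h
      obtain ⟨w, hw, hbw⟩ := hI_surj ((Submodule.Quotient.mk_eq_zero I).1 h)
      obtain ⟨x, hx⟩ := (hexact (m, z - w)).1 (by rw [hgab, map_sub, hbw, hgab]; abel)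
      have hw' : I.mkQ w = 0 := (Submodule.Quotient.mk_eq_zero I).2 hw
      refine ⟨x, Prod.ext ?_ ?_⟩
      · simp [f', hx]
      · simp only [f', LinearMap.comp_apply, hx, LinearMap.prodMap_apply, map_sub, hw', sub_zero]
    · rintro ⟨x, hx⟩
      rw [← hx]
      exact (hg' (f x).1 (f x).2).trans (by rw [Prod.mk.eta, hexact.apply_apply_eq_zero, map_zero])

end GenFinitePaper
end
end

section
/- Let B be a finite-dimensional K-algebra and let X and C be finite-dimensional B-modules such that Ext^i_B(C, C) = 0 for all i > 0 and X ∈ add C. If U is a submodule of X fitting into a short exact sequence 0 → U → C₀ → C₁ → 0 with C₀, C₁ ∈ add C, then Ext^i_B(U, X/U) = 0 for all i > 0. -/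
/- Preliminary notions: `add`, `gen`, `cogen`, generators and cogenerators,
short exact sequences, basic modules, indecomposability. -/

noncomputable section

/- Vanishing of Ext groups, defined via splitting of extensions and dimension shifting. -/

namespace GenFinitePaper

open Function

variable (R : Type) [Ring R]

/-- `Ext¹_R(M, N) = 0`: every short exact sequence `0 → N → X → M → 0` splits. -/
def Ext1Vanish (M : Type) [AddCommGroup M] [Module R M]
    (N : Type) [AddCommGroup N] [Module R N] : Prop :=
  ∀ (X : Type) [AddCommGroup X] [Module R X], ∀ (f : N →ₗ[R] X) (g : X →ₗ[R] M),
    IsShortExact R f g → ∃ s : M →ₗ[R] X, g.comp s = LinearMap.id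

/-- `ExtVanishSucc R i M N` says `Ext^(i+1)_R(M, N) = 0`, defined by dimension shifting:
`Ext^(i+2)(M, N) ≅ Ext^(i+1)(Ω, N)` for any syzygy `0 → Ω → P → M → 0` with `P`
projective. -/
def ExtVanishSucc :
    ℕ → ∀ (M : Type) [AddCommGroup M] [Module R M] (N : Type) [AddCommGroup N] [Module R N],
      Prop
  | 0 => fun M _ _ N _ _ => Ext1Vanish R M N
  | (i + 1) => fun M _ _ N _ _ =>
      ∀ (Ω P : Type) [AddCommGroup Ω] [Module R Ω] [AddCommGroup P] [Module R P],
        ∀ (f : Ω →ₗ[R] P) (g : P →ₗ[R] M), Module.Projective R P → IsShortExact R f g →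
          ExtVanishSucc i Ω N

/-- `Ext^i_R(M, N) = 0` for all `i > 0`. -/
def ExtVanishAll (M : Type) [AddCommGroup M] [Module R M]
    (N : Type) [AddCommGroup N] [Module R N] : Prop :=
  ∀ i : ℕ, ExtVanishSucc R i M N

end GenFinitePaper

namespace GenFinitePaper

section ExtComparison

open CategoryTheory Abelian

variable {R : Type} [Ring R]
variable {M N P Ω : Type} [AddCommGroup M] [Module R M] [AddCommGroup N] [Module R N]
  [AddCommGroup P] [Module R P] [AddCommGroup Ω] [Module R Ω]

/-- The short complex in `ModuleCat R` attached to a short exact sequence of linear maps. -/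
abbrev IsShortExact.shortComplex {f : Ω →ₗ[R] P} {g : P →ₗ[R] M} (h : IsShortExact R f g) :
    ShortComplex (ModuleCat.{0} R) :=
  ModuleCat.shortComplexOfCompEqZero f g h.2.2.linearMap_comp_eq_zero

theorem IsShortExact.shortExact {f : Ω →ₗ[R] P} {g : P →ₗ[R] M} (h : IsShortExact R f g) :
    h.shortComplex.ShortExact :=
  ModuleCat.shortComplex_shortExact _ h.2.2 h.1 h.2.1

/-- The pushout of an extension along a linear map out of its kernel term. -/
theorem IsShortExact.exists_pushout {f : Ω →ₗ[R] P} {g : P →ₗ[R] M} (h : IsShortExact R f g)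
    (φ : Ω →ₗ[R] N) :
    ∃ (Y : Type) (_ : AddCommGroup Y) (_ : Module R Y) (f' : N →ₗ[R] Y) (g' : Y →ₗ[R] M)
      (ψ : P →ₗ[R] Y), IsShortExact R f' g' ∧ f'.comp φ = ψ.comp f ∧ g'.comp ψ = g := by
  obtain ⟨hf, hg, hfg⟩ := h
  let W : Submodule R (N × P) := LinearMap.range (φ.prod (-f))
  have hW : W ≤ LinearMap.ker (g.comp (LinearMap.snd R N P)) := by
    rintro _ ⟨ω, rfl⟩
    simp [hfg.apply_apply_eq_zero]
  refine ⟨(N × P) ⧸ W, inferInstance, inferInstance, W.mkQ.comp (LinearMap.inl R N P),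
    W.liftQ _ hW, W.mkQ.comp (LinearMap.inr R N P), ⟨?_, ?_, ?_⟩, ?_, ?_⟩
  · rw [injective_iff_map_eq_zero]
    intro n hn
    obtain ⟨ω, hω⟩ := (Submodule.Quotient.mk_eq_zero W).1 hn
    have h₁ : φ ω = n := congrArg Prod.fst hω
    have h₂ : -f ω = 0 := congrArg Prod.snd hω
    have h₃ : ω = 0 := hf (by simpa using h₂)
    rw [← h₁, h₃, map_zero]
  · intro m
    obtain ⟨p, rfl⟩ := hg m
    exact ⟨W.mkQ (0, p), by simp⟩
  · intro y
    constructor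
    · obtain ⟨⟨n, p⟩, rfl⟩ := W.mkQ_surjective y
      intro hy
      obtain ⟨ω, rfl⟩ := (hfg p).1 (by simpa using hy)
      refine ⟨n + φ ω, (Submodule.Quotient.eq W).2 ⟨ω, ?_⟩⟩
      simp
    · rintro ⟨n, rfl⟩
      simp
  · ext ω
    exact (Submodule.Quotient.eq W).2 ⟨ω, by simp⟩
  · ext p
    simp

variable (R M) in
/-- Every module has a projective presentation by a free module. -/
theorem exists_projective_isShortExact :
    ∃ (Ω P : Type) (_ : AddCommGroup Ω) (_ : Module R Ω) (_ : AddCommGroup P) (_ : Module R P)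
      (f : Ω →ₗ[R] P) (g : P →ₗ[R] M), Module.Projective R P ∧ IsShortExact R f g :=
  ⟨LinearMap.ker (Finsupp.linearCombination R (id : M → M)), M →₀ R, inferInstance,
    inferInstance, inferInstance, inferInstance, Submodule.subtype _,
    Finsupp.linearCombination R id, inferInstance, Subtype.val_injective,
    Finsupp.linearCombination_id_surjective R M, LinearMap.exact_subtype_ker_map _⟩

theorem ext_eq_zero_of_projective (hP : Module.Projective R P) {i : ℕ}
    (e : Ext (ModuleCat.of R P) (ModuleCat.of R N) (i + 1)) : e = 0 :=
  have := (IsProjective.iff_projective P).1 hP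
  Ext.eq_zero_of_projective e

theorem ext1Vanish_iff :
    Ext1Vanish R M N ↔ Subsingleton (Ext (ModuleCat.of R M) (ModuleCat.of R N) 1) := by
  constructor
  · intro h
    refine subsingleton_of_forall_eq 0 fun x ↦ ?_
    obtain ⟨Ω, P, _, _, _, _, f, g, hP, hfg⟩ := exists_projective_isShortExact R M
    obtain ⟨φ, rfl⟩ := Ext.contravariant_sequence_exact₃ hfg.shortExact (ModuleCat.of R N) x
      (ext_eq_zero_of_projective hP _) (n₀ := 0) rfl
    obtain ⟨φ, rfl⟩ := Ext.addEquiv₀.symm.surjective φ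
    obtain ⟨Y, _, _, f', g', ψ, hY, h₁, h₂⟩ := hfg.exists_pushout φ.hom
    obtain ⟨s, hs⟩ := h Y f' g' hY
    let τ : hfg.shortComplex ⟶ hY.shortComplex :=
      { τ₁ := φ
        τ₂ := ModuleCat.ofHom ψ
        τ₃ := 𝟙 _
        comm₁₂ := ModuleCat.hom_ext h₁
        comm₂₃ := ModuleCat.hom_ext h₂ }
    have hτ := ShortComplex.ShortExact.extClass_naturality hfg.shortExact hY.shortExact τ
    have hs' : ModuleCat.ofHom s ≫ hY.shortComplex.g = 𝟙 _ := ModuleCat.hom_ext hs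
    have hzero : hY.shortExact.extClass = 0 := by
      rw [← Ext.mk₀_id_comp hY.shortExact.extClass, ← hs', ← Ext.mk₀_comp_mk₀,
        Ext.comp_assoc_of_second_deg_zero, hY.shortExact.comp_extClass, Ext.comp_zero]
    rw [hzero, Ext.comp_zero] at hτ
    exact hτ
  · intro h Y _ _ f g hfg
    obtain ⟨s, hs⟩ := Ext.covariant_sequence_exact₃ (ModuleCat.of R M) hfg.shortExact
      (Ext.mk₀ (𝟙 _)) (n₁ := 1) rfl (Subsingleton.elim _ _)
    obtain ⟨s, rfl⟩ := Ext.addEquiv₀.symm.surjective s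
    refine ⟨s.hom, ?_⟩
    have hs' : Ext.mk₀ (s ≫ ModuleCat.ofHom g) = Ext.mk₀ (𝟙 _) := by
      rw [← hs, ← Ext.mk₀_comp_mk₀]
      rfl
    exact congrArg ModuleCat.Hom.hom (Ext.addEquiv₀.symm.injective hs')

theorem extVanishSucc_iff (i : ℕ) :
    ExtVanishSucc R i M N ↔
      Subsingleton (Ext (ModuleCat.of R M) (ModuleCat.of R N) (i + 1)) := by
  induction i generalizing M with
  | zero => exact ext1Vanish_iff
  | succ i ih =>
    constructor
    · intro h
      refine subsingleton_of_forall_eq 0 fun x ↦ ?_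
      obtain ⟨Ω, P, _, _, _, _, f, g, hP, hfg⟩ := exists_projective_isShortExact R M
      have := ih.1 (h Ω P f g hP hfg)
      obtain ⟨y, rfl⟩ := Ext.contravariant_sequence_exact₃ hfg.shortExact (ModuleCat.of R N) x
        (ext_eq_zero_of_projective hP _) (n₀ := i + 1) (by lia)
      rw [Subsingleton.elim y 0, Ext.comp_zero]
    · intro h Ω P _ _ _ _ f g hP hfg
      refine ih.2 (subsingleton_of_forall_eq 0 fun x ↦ ?_)
      obtain ⟨y, rfl⟩ := Ext.contravariant_sequence_exact₁ hfg.shortExact (ModuleCat.of R N) x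
        (n₁ := i + 1 + 1) (by lia) (Subsingleton.elim _ _)
      rw [ext_eq_zero_of_projective hP y, Ext.comp_zero]

theorem extVanishAll_iff :
    ExtVanishAll R M N ↔
      ∀ i : ℕ, Subsingleton (Ext (ModuleCat.of R M) (ModuleCat.of R N) (i + 1)) :=
  forall_congr' extVanishSucc_iff

variable {C : Type} [AddCommGroup C] [Module R C]

theorem InAdd.exists_sum_eq_id (h : InAdd R C M) :
    ∃ (n : ℕ) (a : Fin n → (ModuleCat.of R M ⟶ ModuleCat.of R C))
      (b : Fin n → (ModuleCat.of R C ⟶ ModuleCat.of R M)), ∑ j, a j ≫ b j = 𝟙 _ := by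
  obtain ⟨n, i, p, hip⟩ := h
  refine ⟨n, fun j ↦ ModuleCat.ofHom ((LinearMap.proj j).comp i),
    fun j ↦ ModuleCat.ofHom (p.comp (LinearMap.single R (fun _ ↦ C) j)), ?_⟩
  ext m
  have hm : p (i m) = m := LinearMap.congr_fun hip m
  have hsum : ∑ j, p (Pi.single j (i m j)) = m := by
    rw [← map_sum, Finset.univ_sum_single, hm]
  simpa [ModuleCat.hom_sum] using hsum

theorem InAdd.subsingleton_ext_right (h : InAdd R C M) {A : ModuleCat.{0} R} {i : ℕ}
    (hA : Subsingleton (Ext A (ModuleCat.of R C) i)) :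
    Subsingleton (Ext A (ModuleCat.of R M) i) := by
  obtain ⟨n, a, b, hab⟩ := h.exists_sum_eq_id
  refine subsingleton_of_forall_eq 0 fun x ↦ ?_
  rw [← Ext.comp_mk₀_id x, ← hab, Ext.mk₀_sum, Ext.comp_sum]
  refine Finset.sum_eq_zero fun j _ ↦ ?_
  rw [← Ext.mk₀_comp_mk₀, ← Ext.comp_assoc_of_third_deg_zero,
    Subsingleton.elim (x.comp (Ext.mk₀ (a j)) (add_zero i)) 0, Ext.zero_comp]

theorem InAdd.subsingleton_ext_left (h : InAdd R C M) {A : ModuleCat.{0} R} {i : ℕ}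
    (hA : Subsingleton (Ext (ModuleCat.of R C) A i)) :
    Subsingleton (Ext (ModuleCat.of R M) A i) := by
  obtain ⟨n, a, b, hab⟩ := h.exists_sum_eq_id
  refine subsingleton_of_forall_eq 0 fun x ↦ ?_
  rw [← Ext.mk₀_id_comp x, ← hab, Ext.mk₀_sum, Ext.sum_comp]
  refine Finset.sum_eq_zero fun j _ ↦ ?_
  rw [← Ext.mk₀_comp_mk₀, Ext.comp_assoc_of_second_deg_zero,
    Subsingleton.elim ((Ext.mk₀ (b j)).comp x (zero_add i)) 0, Ext.comp_zero]

end ExtComparison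

section LongExactSequence

open CategoryTheory Abelian

universe w v u

variable {𝒜 : Type u} [Category.{v} 𝒜] [Abelian 𝒜] [HasExt.{w} 𝒜]
  {S : ShortComplex 𝒜}

theorem subsingleton_ext_X₁_left (hS : S.ShortExact) {Y : 𝒜} {i : ℕ}
    (h₂ : Subsingleton (Ext S.X₂ Y i))
    (h₃ : Subsingleton (Ext S.X₃ Y (i + 1))) : Subsingleton (Ext S.X₁ Y i) := by
  refine subsingleton_of_forall_eq 0 fun x ↦ ?_
  obtain ⟨y, rfl⟩ := Ext.contravariant_sequence_exact₁ hS Y x (add_comm 1 i)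
    (Subsingleton.elim _ _)
  rw [Subsingleton.elim y 0, Ext.comp_zero]

theorem subsingleton_ext_X₁_right (hS : S.ShortExact) {Y : 𝒜} {i : ℕ}
    (h₃ : Subsingleton (Ext Y S.X₃ i))
    (h₂ : Subsingleton (Ext Y S.X₂ (i + 1))) : Subsingleton (Ext Y S.X₁ (i + 1)) := by
  refine subsingleton_of_forall_eq 0 fun x ↦ ?_
  obtain ⟨y, rfl⟩ := Ext.covariant_sequence_exact₁ Y hS x (Subsingleton.elim _ _) rfl
  rw [Subsingleton.elim y 0, Ext.zero_comp]

theorem subsingleton_ext_X₃_right (hS : S.ShortExact) {Y : 𝒜} {i : ℕ}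
    (h₂ : Subsingleton (Ext Y S.X₂ i))
    (h₁ : Subsingleton (Ext Y S.X₁ (i + 1))) : Subsingleton (Ext Y S.X₃ i) := by
  refine subsingleton_of_forall_eq 0 fun x ↦ ?_
  obtain ⟨y, rfl⟩ := Ext.covariant_sequence_exact₃ Y hS x rfl (Subsingleton.elim _ _)
  rw [Subsingleton.elim y 0, Ext.zero_comp]

end LongExactSequence

/-- Let `B` be a finite-dimensional `K`-algebra, `X` and `C`
finite-dimensional `B`-modules with `Ext^i_B(C, C) = 0` for all `i > 0` and `X ∈ add C`.
If `U ≤ X` is a submodule fitting into a short exact sequence `0 → U → C₀ → C₁ → 0` with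
`C₀, C₁ ∈ add C`, then `Ext^i_B(U, X/U) = 0` for all `i > 0`. -/
theorem ext_vanishing_for_subobjects_coresolved_by_C
    (K B : Type) [Field K] [Ring B] [Algebra K B] [FiniteDimensional K B]
    (X C : Type) [AddCommGroup X] [Module B X] [AddCommGroup C] [Module B C]
    (hXfin : Module.Finite B X) (hCfin : Module.Finite B C)
    (hC : ExtVanishAll B C C) (hXC : InAdd B C X)
    (U : Submodule B X)
    (C₀ C₁ : Type) [AddCommGroup C₀] [Module B C₀] [AddCommGroup C₁] [Module B C₁]
    (hC₀ : InAdd B C C₀) (hC₁ : InAdd B C C₁)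
    (f : U →ₗ[B] C₀) (g : C₀ →ₗ[B] C₁) (hses : IsShortExact B f g) :
    ExtVanishAll B U (X ⧸ U) := by
  have hq : IsShortExact B U.subtype U.mkQ :=
    ⟨U.subtype_injective, U.mkQ_surjective, LinearMap.exact_subtype_mkQ U⟩
  rw [extVanishAll_iff] at hC ⊢
  have hUC (i : ℕ) : Subsingleton
      (CategoryTheory.Abelian.Ext (ModuleCat.of B U) (ModuleCat.of B C) (i + 1)) :=
    subsingleton_ext_X₁_left hses.shortExact (hC₀.subsingleton_ext_left (hC i))
      (hC₁.subsingleton_ext_left (hC (i + 1)))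
  intro i
  refine subsingleton_ext_X₃_right hq.shortExact (hXC.subsingleton_ext_right (hUC i)) ?_
  exact subsingleton_ext_X₁_right hses.shortExact (hC₁.subsingleton_ext_right (hUC i))
    (hC₀.subsingleton_ext_right (hUC (i + 1)))

end GenFinitePaper
end
end

section
/- Let A be a finite-dimensional K-algebra and e ∈ B an idempotent in a finite-dimensional algebra B with A = eBe, and let c : mod A → mod B be the corresponding intermediate extension functor. If Y is a B-module admitting an epimorphism p : c(X) → Y and a monomorphism i : Y → c(Z) for some A-modules X and Z, then Y lies in the essential image of c; more precisely, writing i∘p = c(g) for the unique g : X → Z (using full faithfulness of c), one has Y ≅ c(Im g). -/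
/- Statement 14: modules sandwiched between intermediate extensions lie in the image of
the intermediate extension functor. -/

noncomputable section

namespace GenFinitePaper

open CategoryTheory CategoryTheory.Limits

/-- Let `A = eBe` for an idempotent `e` of a finite-dimensional
`K`-algebra `B`, and let `c : mod A → mod B` be the corresponding intermediate extension
functor; `c` is fully faithful and preserves epimorphisms and monomorphisms (these are
the properties of `c` used here, and we take them as hypotheses characterising it).  If a
`B`-module `Y` admits an epimorphism `p : c(X) → Y` and a monomorphism `i : Y → c(Z)`,
and `g : X → Z` is the (unique, by full faithfulness) morphism with `c(g) = i ∘ p`, then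
`Y` lies in the essential image of `c`; more precisely `Y ≅ c(Im g)`. -/
theorem sandwiched_module_in_image_of_intermediate_extension
    (K A B : Type) [Field K] [Ring A] [Algebra K A] [FiniteDimensional K A]
    [Ring B] [Algebra K B] [FiniteDimensional K B]
    (c : ModuleCat.{0} A ⥤ ModuleCat.{0} B) [c.Full] [c.Faithful]
    (hepi : ∀ {X Y : ModuleCat.{0} A} (f : X ⟶ Y), Epi f → Epi (c.map f))
    (hmono : ∀ {X Y : ModuleCat.{0} A} (f : X ⟶ Y), Mono f → Mono (c.map f))
    (X Z : ModuleCat.{0} A) (Y : ModuleCat.{0} B)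
    (p : c.obj X ⟶ Y) (i : Y ⟶ c.obj Z) [Epi p] [Mono i]
    (g : X ⟶ Z) (hg : c.map g = p ≫ i) :
    (∃ W : ModuleCat.{0} A, Nonempty (Y ≅ c.obj W)) ∧
      Nonempty (Y ≅ c.obj (image g)) := by
  have := hepi (factorThruImage g) inferInstance
  have := hmono (image.ι g) inferInstance
  have := strongEpi_of_epi p
  have := strongEpi_of_epi (c.map (factorThruImage g))
  have hfac : c.map (factorThruImage g) ≫ c.map (image.ι g) = c.map g := by
    rw [← c.map_comp, image.fac]
  let e : Y ≅ c.obj (image g) :=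
    image.isoStrongEpiMono p i hg.symm ≪≫
      (image.isoStrongEpiMono (c.map (factorThruImage g)) (c.map (image.ι g)) hfac).symm
  exact ⟨⟨image g, ⟨e⟩⟩, ⟨e⟩⟩

end GenFinitePaper
end
end
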